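/- There exist Levi-flat 5-manifolds (M₁, 𝓕₁, J_{𝓕₁}) and (M₂, 𝓕₂, J_{𝓕₂}) such that: (i) (M₁, 𝓕₁, J_{𝓕₁}) does not admit a Levi-flat C^∞-embedding into any complex 3-manifold, (ii) (M₂, 𝓕₂, J_{𝓕₂}) admits a Levi-flat C^∞-embedding into ℂ³, and (iii) (M₁, 𝓕₁) and (M₂, 𝓕₂) are diffeomorphic as C^∞-foliated manifolds. -/

import Mathlib

/-!
STATEMENT 1 (Corollary `cor:main`): there exist Levi-flat `5`-manifolds
`(M₁, 𝓕₁, J_{𝓕₁})` and `(M₂, 𝓕₂, J_{𝓕₂})` such that (i) `(M₁, 𝓕₁, J_{𝓕₁})`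
does not admit a Levi-flat `C^∞`-embedding into any complex `3`-manifold,
(ii) `(M₂, 𝓕₂, J_{𝓕₂})` admits a Levi-flat `C^∞`-embedding into `ℂ³`, and
(iii) `(M₁, 𝓕₁)` and `(M₂, 𝓕₂)` are diffeomorphic as `C^∞`-foliated
manifolds.
-/

open Complex Set Topology Filter

namespace LeviFlat

/-- Chart model space of a Levi-flat `(2n+1)`-manifold: `ℂⁿ × ℝ`. -/
abbrev Model (n : ℕ) := (Fin n → ℂ) × ℝ

/-- A Levi-flat manifold `(M, 𝓕, J_𝓕)` of dimension `2n+1`: a smooth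
codimension-one foliated manifold with a transversely smooth leafwise complex
structure, presented by an atlas of foliation charts `φ_j : U_j → ℂⁿ × ℝ`
whose transitions have the form `(z, u) ↦ (f_{jk}(z, u), g_{jk}(u))` with
`f_{jk}` holomorphic in `z` and everything smooth. -/
structure Mfld (n : ℕ) where
  M : Type
  [ts : TopologicalSpace M]
  ι : Type
  U : ι → Set M
  U_open : ∀ j, IsOpen (U j)
  covers : ∀ x : M, ∃ j, x ∈ U j
  φ : ι → M → Model n
  φ_cont : ∀ j, ContinuousOn (φ j) (U j)
  φ_inj : ∀ j, InjOn (φ j) (U j)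
  φ_openMap : ∀ j, ∀ V ⊆ U j, IsOpen V → IsOpen (φ j '' V)
  /-- transitions are smooth, preserve the transversal coordinate `u`
  (i.e. are foliated), and are leafwise holomorphic -/
  trans : ∀ j k, ∃ F : Model n → Model n,
    ContDiffOn ℝ (⊤ : ℕ∞) F (φ j '' (U j ∩ U k)) ∧
    (∀ x ∈ U j ∩ U k, φ k x = F (φ j x)) ∧
    (∀ p ∈ φ j '' (U j ∩ U k), ∀ q ∈ φ j '' (U j ∩ U k),
      p.2 = q.2 → (F p).2 = (F q).2) ∧
    (∀ p ∈ φ j '' (U j ∩ U k),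
      DifferentiableWithinAt ℂ (fun z => (F (z, p.2)).1)
        {z | (z, p.2) ∈ φ j '' (U j ∩ U k)} p.1)

attribute [instance] Mfld.ts

variable {n : ℕ}

/-- Two points lie on a common plaque. -/
def plaqueRel (S : Mfld n) (x y : S.M) : Prop :=
  ∃ j, x ∈ S.U j ∧ y ∈ S.U j ∧ (S.φ j x).2 = (S.φ j y).2

/-- The leaf of `𝓕` through `x`: the equivalence class of `x` under chains of
plaques. -/
def Leaf (S : Mfld n) (x : S.M) : Set S.M :=
  {y | Relation.EqvGen (plaqueRel S) x y}

/-- `L` is a leaf of `𝓕`. -/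
def IsLeaf (S : Mfld n) (L : Set S.M) : Prop := ∃ x, L = Leaf S x

/-- `f` is a holomorphic function on the part `A` of a leaf (expressed in
foliation charts). -/
def LeafwiseHolomorphicOn (S : Mfld n) (f : S.M → ℂ) (A : Set S.M) : Prop :=
  ∀ j, ∃ F : Model n → ℂ,
    (∀ x ∈ S.U j ∩ A, F (S.φ j x) = f x) ∧
    ∀ p ∈ S.φ j '' (S.U j ∩ A),
      DifferentiableWithinAt ℂ (fun z => F (z, p.2))
        {z | (z, p.2) ∈ S.φ j '' (S.U j ∩ A)} p.1

/-- `C` is an elliptic curve holomorphically embedded in the leaf `L`: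
`C ⊆ L` is compact and is the image of a leafwise holomorphic covering map
`π : ℂ → C` with deck group the lattice `ℤ + ℤτ₀`. -/
def IsEllipticCurveIn (S : Mfld n) (L C : Set S.M) : Prop :=
  C ⊆ L ∧ IsCompact C ∧
  ∃ τ0 : ℂ, 0 < τ0.im ∧ ∃ π : ℂ → S.M,
    Continuous π ∧ range π = C ∧
    (∀ j, ∀ ζ : ℂ, π ζ ∈ S.U j →
      DifferentiableWithinAt ℂ (fun ξ => (S.φ j (π ξ)).1) {ξ | π ξ ∈ S.U j} ζ) ∧
    (∀ ζ ξ : ℂ, π ζ = π ξ ↔ ∃ a b : ℤ, ξ - ζ = (a : ℂ) + (b : ℂ) * τ0)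

/-- `g` transports the transversal coordinate of the chart `j` to that of the
chart `k`. -/
def TransU (S : Mfld n) (j k : S.ι) (g : ℝ → ℝ) : Prop :=
  ∀ x ∈ S.U j ∩ S.U k, (S.φ k x).2 = g ((S.φ j x).2)

/-- Composition along a chain of charts. -/
def chainComp (g : ℕ → ℝ → ℝ) : ℕ → ℝ → ℝ
  | 0 => id
  | i + 1 => g i ∘ chainComp g i

/-- Germ equality at `u₀`. -/
def GermEqAt (u0 : ℝ) (f g : ℝ → ℝ) : Prop := ∀ᶠ u in nhds u0, f u = g u

/-- `h` represents a holonomy germ of `𝓕` at the transversal point over `x₀`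
in the chart `j₀`, along a loop (chain of foliation charts contained in `𝓤`,
with consecutive overlaps meeting `A`) based in `A`. -/
def IsHolonomyGermAlong (S : Mfld n) (𝓤 A : Set S.M) (x0 : S.M) (j0 : S.ι)
    (h : ℝ → ℝ) : Prop :=
  ∃ (N : ℕ) (c : ℕ → S.ι) (g : ℕ → ℝ → ℝ),
    c 0 = j0 ∧ c N = j0 ∧
    (∀ i ≤ N, S.U (c i) ⊆ 𝓤) ∧
    (∀ i < N, TransU S (c i) (c (i + 1)) (g i)) ∧
    (∀ i < N, (S.U (c i) ∩ S.U (c (i + 1)) ∩ A).Nonempty) ∧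
    GermEqAt ((S.φ j0 x0).2) h (chainComp g N)

/-- The germ at `u₀` of `φh` is contracting. -/
def ContractingAt (u0 : ℝ) (φh : ℝ → ℝ) : Prop :=
  φh u0 = u0 ∧ ∃ δ > (0 : ℝ), ∀ u : ℝ, u ≠ u0 → |u - u0| < δ →
    |φh u - u0| < |u - u0|

/-- The germ at `u₀` of `φh` is `C^∞`-flat (tangent to the identity to
infinite order). -/
def CInftyFlatAt (u0 : ℝ) (φh : ℝ → ℝ) : Prop :=
  ∀ m : ℕ, iteratedDeriv m (fun u => φh u - u) u0 = 0

/-- Hypothesis (i) of the main theorems: the holonomy group `𝓗(𝓤 ∩ L)` is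
isomorphic to `ℤ`, generated by a `C^∞`-flat contracting holonomy along an
element of `π₁(A)` (`A = C`, resp. `A = E`). -/
def HolonomyZFlatContracting (S : Mfld n) (𝓤 L A : Set S.M) : Prop :=
  ∃ x0 ∈ A, ∃ j0, x0 ∈ S.U j0 ∧ S.U j0 ⊆ 𝓤 ∧
    ∃ φh : ℝ → ℝ,
      CInftyFlatAt ((S.φ j0 x0).2) φh ∧
      ContractingAt ((S.φ j0 x0).2) φh ∧
      -- the generator is a holonomy along a loop in `A`
      IsHolonomyGermAlong S 𝓤 A x0 j0 φh ∧
      -- the generator has infinite order (the group is `≅ ℤ`)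
      (∀ m : ℕ, 0 < m → ¬ GermEqAt ((S.φ j0 x0).2) (φh^[m]) id) ∧
      -- every holonomy germ of `𝓕` along `𝓤 ∩ L` is a power of the generator
      (∀ h : ℝ → ℝ, IsHolonomyGermAlong S 𝓤 (𝓤 ∩ L) x0 j0 h →
        ∃ m : ℕ, GermEqAt ((S.φ j0 x0).2) h (φh^[m]) ∨
          GermEqAt ((S.φ j0 x0).2) (h ∘ φh^[m]) id)

/-- Hypothesis (ii) of the main theorems: a `C^∞` retraction
`p : 𝓤 → 𝓤 ∩ L` whose restriction to each leaf is locally biholomorphic and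
surjective. -/
def IsLeafwiseRetraction (S : Mfld n) (𝓤 L : Set S.M) (P : S.M → S.M) : Prop :=
  ContinuousOn P 𝓤 ∧
  (∀ x ∈ 𝓤, P x ∈ 𝓤 ∩ L) ∧
  (∀ x ∈ 𝓤 ∩ L, P x = x) ∧
  -- `P` is `C^∞` and leafwise holomorphic, in foliation charts
  (∀ j k, ∃ F : Model n → Model n,
    ContDiffOn ℝ (⊤ : ℕ∞) F (S.φ j '' (S.U j ∩ 𝓤 ∩ P ⁻¹' (S.U k))) ∧
    (∀ x ∈ S.U j ∩ 𝓤 ∩ P ⁻¹' (S.U k), S.φ k (P x) = F (S.φ j x)) ∧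
    (∀ p ∈ S.φ j '' (S.U j ∩ 𝓤 ∩ P ⁻¹' (S.U k)),
      DifferentiableWithinAt ℂ (fun z => (F (z, p.2)).1)
        {z | (z, p.2) ∈ S.φ j '' (S.U j ∩ 𝓤 ∩ P ⁻¹' (S.U k))} p.1)) ∧
  -- the restriction of `P` to each leaf is locally injective …
  (∀ x ∈ 𝓤, ∃ V ∈ nhds x, InjOn P (V ∩ Leaf S x)) ∧
  -- … and surjective onto `𝓤 ∩ L`
  (∀ x ∈ 𝓤, 𝓤 ∩ L ⊆ P '' (Leaf S x ∩ 𝓤))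

/-- A complex `m`-manifold, presented by a holomorphic atlas. -/
structure Cpx (m : ℕ) where
  X : Type
  [ts : TopologicalSpace X]
  κ : Type
  O : κ → Set X
  O_open : ∀ a, IsOpen (O a)
  covers : ∀ x : X, ∃ a, x ∈ O a
  ψ : κ → X → (Fin m → ℂ)
  ψ_cont : ∀ a, ContinuousOn (ψ a) (O a)
  ψ_inj : ∀ a, InjOn (ψ a) (O a)
  ψ_openMap : ∀ a, ∀ V ⊆ O a, IsOpen V → IsOpen (ψ a '' V)
  trans : ∀ a b, ∃ F : (Fin m → ℂ) → (Fin m → ℂ),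
    DifferentiableOn ℂ F (ψ a '' (O a ∩ O b)) ∧
    ∀ x ∈ O a ∩ O b, ψ b x = F (ψ a x)

attribute [instance] Cpx.ts

/-- A Levi-flat `C^∞`-embedding of the Levi-flat manifold `(M, 𝓕, J_𝓕)` into
the complex manifold `X`: a smooth embedding which is an immersion, whose
image is foliated by the images of the leaves, these being immersed complex
submanifolds (the embedding is leafwise holomorphic); for `m = n + 1` the
image is a Levi-flat real hypersurface inducing `(𝓕, J_𝓕)`. -/
def IsLeviFlatEmbedding {m : ℕ} (S : Mfld n) (X : Cpx m) (e : S.M → X.X) : Prop :=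
  Topology.IsEmbedding e ∧
  ∀ j a, ∃ F : Model n → (Fin m → ℂ),
    ContDiffOn ℝ (⊤ : ℕ∞) F (S.φ j '' (S.U j ∩ e ⁻¹' (X.O a))) ∧
    (∀ x ∈ S.U j ∩ e ⁻¹' (X.O a), X.ψ a (e x) = F (S.φ j x)) ∧
    -- `e` is an immersion
    (∀ p ∈ S.φ j '' (S.U j ∩ e ⁻¹' (X.O a)),
      Function.Injective
        (fderivWithin ℝ F (S.φ j '' (S.U j ∩ e ⁻¹' (X.O a))) p)) ∧
    -- `e` is leafwise holomorphic
    (∀ p ∈ S.φ j '' (S.U j ∩ e ⁻¹' (X.O a)),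
      DifferentiableWithinAt ℂ (fun z => F (z, p.2))
        {z | (z, p.2) ∈ S.φ j '' (S.U j ∩ e ⁻¹' (X.O a))} p.1)

/-- `(M, 𝓕, J_𝓕)` admits a Levi-flat `C^∞`-embedding into some complex
`m`-manifold. -/
def AdmitsLeviFlatEmbedding (S : Mfld n) (m : ℕ) : Prop :=
  ∃ (X : Cpx m) (e : S.M → X.X), IsLeviFlatEmbedding S X e

end LeviFlat

open LeviFlat

variable {n : ℕ}

/-- `ℂ^m` as a complex manifold (a single chart, the identity). -/
noncomputable def stdCpx (m : ℕ) : Cpx m where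
  X := Fin m → ℂ
  κ := Unit
  O := fun _ => Set.univ
  O_open := fun _ => isOpen_univ
  covers := fun _ => ⟨(), Set.mem_univ _⟩
  ψ := fun _ x => x
  ψ_cont := fun _ => continuous_id.continuousOn
  ψ_inj := fun _ x _ y _ h => h
  ψ_openMap := fun _ V _ hV => by simpa using hV
  trans := fun _ _ => ⟨id, differentiableOn_id, fun _ _ => rfl⟩

/-- `(M₁, 𝓕₁)` and `(M₂, 𝓕₂)` are diffeomorphic as `C^∞`-foliated manifolds:
a homeomorphism carrying leaves onto leaves, which is `C^∞` in foliation
charts in both directions. -/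
def FoliatedDiffeomorphic (S1 S2 : Mfld n) : Prop :=
  ∃ e : S1.M ≃ₜ S2.M,
    (∀ x : S1.M, e '' Leaf S1 x = Leaf S2 (e x)) ∧
    (∀ j k, ∃ F : Model n → Model n,
      ContDiffOn ℝ (⊤ : ℕ∞) F (S1.φ j '' (S1.U j ∩ e ⁻¹' (S2.U k))) ∧
      ∀ x ∈ S1.U j ∩ e ⁻¹' (S2.U k), S2.φ k (e x) = F (S1.φ j x)) ∧
    (∀ k j, ∃ F : Model n → Model n,
      ContDiffOn ℝ (⊤ : ℕ∞) F (S2.φ k '' (S2.U k ∩ e.symm ⁻¹' (S1.U j))) ∧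
      ∀ y ∈ S2.U k ∩ e.symm ⁻¹' (S1.U j), S1.φ j (e.symm y) = F (S2.φ k y))

section HolomorphicMaps

open Metric Asymptotics

variable {E F : Type*} [NormedAddCommGroup E] [NormedSpace ℂ E]
  [NormedAddCommGroup F] [NormedSpace ℂ F]

/-- Cauchy's estimate for the first derivative. -/
theorem norm_fderiv_le_of_norm_le_ball {f : E → F} {x : E} {R M : ℝ} (hR : 0 < R)
    (hd : DifferentiableOn ℂ f (ball x R)) (hM : ∀ y ∈ ball x R, ‖f y‖ ≤ M) :
    ‖fderiv ℂ f x‖ ≤ 2 * M / R := by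
  refine Complex.norm_fderiv_le_div_of_mapsTo_ball hd (fun y hy => ?_) hR
  rw [mem_closedBall, dist_eq_norm]
  have h1 := hM y hy
  have h2 := hM x (mem_ball_self hR)
  linarith [norm_sub_le (f y) (f x)]

/-- Quadratic bound for the first order Taylor remainder of a bounded holomorphic map. -/
theorem norm_sub_sub_fderiv_le {f : E → F} {x : E} {R M : ℝ}
    (hd : DifferentiableOn ℂ f (ball x R)) (hM : ∀ y ∈ ball x R, ‖f y‖ ≤ M) {y : E}
    (hy : y ∈ ball x R) :
    ‖f y - f x - fderiv ℂ f x (y - x)‖ ≤ 4 * M * (‖y - x‖ / R) ^ 2 := by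
  have hR : 0 < R := nonempty_ball.mp ⟨_, hy⟩
  set L := fderiv ℂ f x with hL
  have hLn : ‖L‖ ≤ 2 * M / R := norm_fderiv_le_of_norm_le_ball hR hd hM
  have hM0 : 0 ≤ M := (norm_nonneg _).trans (hM y hy)
  have hfx : HasFDerivAt f L x :=
    ((hd x (mem_ball_self hR)).differentiableAt (ball_mem_nhds x hR)).hasFDerivAt
  have key := Complex.dist_le_mul_div_pow_of_mapsTo_ball_of_isLittleO
    (f := fun z => f z - L (z - x)) (c := x) (z := y) (R₁ := R) (R₂ := 4 * M) (n := 1)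
    (hd.sub (L.differentiable.comp (differentiable_id.sub_const x)).differentiableOn)
    (fun z hz => ?_) ?_ hy
  · simpa [dist_eq_norm, sub_right_comm] using key
  · rw [mem_closedBall, dist_eq_norm]
    have h1 := hM z hz
    have h2 := hM x (mem_ball_self hR)
    have h3 : ‖L (z - x)‖ ≤ 2 * M := by
      refine (L.le_opNorm _).trans ?_
      have h4 : ‖z - x‖ ≤ R := by simpa [dist_eq_norm] using (mem_ball.1 hz).le
      calc ‖L‖ * ‖z - x‖ ≤ 2 * M / R * R := by gcongr
        _ = 2 * M := by field_simp
    have h5 : f z - L (z - x) - (f x - L (x - x)) = (f z - f x) - L (z - x) := by simp; abel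
    rw [h5]
    linarith [norm_sub_le (f z - f x) (L (z - x)), norm_sub_le (f z) (f x)]
  · have h := (hasFDerivAt_iff_isLittleO.1 hfx).norm_right
    simpa [sub_right_comm] using h

/-- A locally uniform limit of holomorphic maps between normed spaces is holomorphic. -/
theorem differentiableAt_of_tendstoUniformlyOn_ball [CompleteSpace F] {ι : Type*} {l : Filter ι}
    [l.NeBot] {f : ι → E → F} {g : E → F} {x : E} {R : ℝ} (hR : 0 < R)
    (hf : ∀ᶠ i in l, DifferentiableOn ℂ (f i) (ball x R))
    (hfg : TendstoUniformlyOn f g l (ball x R)) : DifferentiableAt ℂ g x := by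
  have hsub : ∀ y ∈ ball x (R / 2), ball y (R / 2) ⊆ ball x R := fun y hy =>
    ball_subset_ball' (by have := mem_ball.1 hy; linarith)
  have hcauchy : UniformCauchySeqOn (fun i y => fderiv ℂ (f i) y) l (ball x (R / 2)) := by
    intro u hu
    obtain ⟨ε, hε, hεu⟩ := Metric.mem_uniformity_dist.1 hu
    have h1 := hfg.uniformCauchySeqOn _ (Metric.dist_mem_uniformity
      (show 0 < ε * R / 8 by positivity))
    filter_upwards [h1, (hf.prod_mk hf)] with i hi hdi y hy
    apply hεu
    have hd1 : DifferentiableAt ℂ (f i.1) y := (hdi.1 y (hsub y hy (mem_ball_self (by positivity)))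
      ).differentiableAt (isOpen_ball.mem_nhds (hsub y hy (mem_ball_self (by positivity))))
    have hd2 : DifferentiableAt ℂ (f i.2) y := (hdi.2 y (hsub y hy (mem_ball_self (by positivity)))
      ).differentiableAt (isOpen_ball.mem_nhds (hsub y hy (mem_ball_self (by positivity))))
    have h2 := norm_fderiv_le_of_norm_le_ball (f := fun z => f i.1 z - f i.2 z) (x := y)
      (R := R / 2) (M := ε * R / 8) (by positivity)
      ((hdi.1.sub hdi.2).mono (hsub y hy)) (fun z hz => by
        have := hi z (hsub y hy hz)
        simp only [dist_eq_norm] at this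
        exact this.le)
    rw [fderiv_fun_sub hd1 hd2] at h2
    rw [dist_eq_norm]
    refine h2.trans_lt ?_
    have : 2 * (ε * R / 8) / (R / 2) = ε / 2 := by field_simp; norm_num
    rw [this]; linarith
  have hlim : ∀ y ∈ ball x (R / 2), ∃ L, Tendsto (fun i => fderiv ℂ (f i) y) l (𝓝 L) :=
    fun y hy => CompleteSpace.complete (hcauchy.cauchy_map hy)
  choose! g' hg' using hlim
  have hunif := hcauchy.tendstoUniformlyOn_of_tendsto hg'
  have hxR : ball x (R / 2) ∈ 𝓝 x := ball_mem_nhds x (by positivity)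
  refine (hasFDerivAt_of_tendstoUniformlyOnFilter (g' := g') (f := f) (l := l)
    (hunif.tendstoUniformlyOnFilter.mono_right (le_principal_iff.2 hxR)) ?_ ?_).differentiableAt
  · filter_upwards [hf.prod_mk (eventually_mem_set.2 hxR)] with n hn
    exact ((hn.1 _ (hsub _ hn.2 (mem_ball_self (by positivity)))).differentiableAt
      (isOpen_ball.mem_nhds (hsub _ hn.2 (mem_ball_self (by positivity))))).hasFDerivAt
  · filter_upwards [hxR] with y hy
    exact hfg.tendsto_at (hsub y hy (mem_ball_self (by positivity)))

/-- Directional derivatives of a holomorphic map between normed spaces are holomorphic. -/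
theorem DifferentiableOn.fderiv_apply_complex [CompleteSpace F] {f : E → F} {U : Set E}
    (hU : IsOpen U) (hf : DifferentiableOn ℂ f U) (w : E) :
    DifferentiableOn ℂ (fun x => fderiv ℂ f x w) U := by
  intro x hx
  -- a ball on which `f` is bounded
  have hcont : ContinuousAt f x := (hf.continuousOn).continuousAt (hU.mem_nhds hx)
  obtain ⟨R, hR, hRU⟩ := Metric.mem_nhds_iff.1 (inter_mem (hU.mem_nhds hx)
    (hcont.norm.eventually (gt_mem_nhds (lt_add_one ‖f x‖))))
  set M := ‖f x‖ + 1
  have hM : ∀ y ∈ ball x R, ‖f y‖ ≤ M := fun y hy => (hRU hy).2.le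
  have hfR : DifferentiableOn ℂ f (ball x R) := hf.mono fun y hy => (hRU hy).1
  have hsub : ∀ y ∈ ball x (R / 2), ball y (R / 2) ⊆ ball x R := fun y hy =>
    ball_subset_ball' (by have := mem_ball.1 hy; linarith)
  have hM0 : 0 ≤ M := by positivity
  refine (differentiableAt_of_tendstoUniformlyOn_ball (l := 𝓝[≠] (0 : ℂ))
    (f := fun (s : ℂ) y => s⁻¹ • (f (y + s • w) - f y)) (R := R / 2) (by positivity)
    ?_ ?_).differentiableWithinAt
  · have h0 : Tendsto (fun s : ℂ => s • w) (𝓝[≠] 0) (𝓝 0) := by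
      have : Tendsto (fun s : ℂ => s • w) (𝓝 0) (𝓝 ((0 : ℂ) • w)) :=
        (continuous_id.smul continuous_const).tendsto 0
      rw [zero_smul] at this
      exact this.mono_left nhdsWithin_le_nhds
    filter_upwards [h0.eventually (ball_mem_nhds 0 (show 0 < R / 2 by positivity))] with s hs
    have hmap : ∀ y ∈ ball x (R / 2), y + s • w ∈ ball x R := fun y hy => hsub y hy (by
      simpa [dist_eq_norm] using hs)
    refine DifferentiableOn.const_smul (DifferentiableOn.sub ?_ (hfR.mono ?_)) _
    · exact hfR.comp (differentiable_id.add_const _).differentiableOn hmap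
    · exact ball_subset_ball (by linarith)
  · rw [Metric.tendstoUniformlyOn_iff]
    intro ε hε
    have h0 : Tendsto (fun s : ℂ => ‖s‖ * (4 * M * (‖w‖ / (R / 2)) ^ 2)) (𝓝[≠] 0) (𝓝 0) := by
      have : Continuous (fun s : ℂ => ‖s‖ * (4 * M * (‖w‖ / (R / 2)) ^ 2)) := by fun_prop
      have := this.tendsto 0
      rw [norm_zero, zero_mul] at this
      exact this.mono_left nhdsWithin_le_nhds
    have h1 : Tendsto (fun s : ℂ => ‖s‖ * ‖w‖) (𝓝[≠] 0) (𝓝 0) := by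
      have : Continuous (fun s : ℂ => ‖s‖ * ‖w‖) := by fun_prop
      have := this.tendsto 0
      rw [norm_zero, zero_mul] at this
      exact this.mono_left nhdsWithin_le_nhds
    filter_upwards [h0.eventually (gt_mem_nhds hε),
      h1.eventually (gt_mem_nhds (show 0 < R / 2 by positivity)), self_mem_nhdsWithin]
      with s hs hs1 hs0 y hy
    have hs0' : s ≠ 0 := hs0
    have hmem : y + s • w ∈ ball y (R / 2) := by
      simpa [dist_eq_norm, norm_smul] using hs1
    have key := norm_sub_sub_fderiv_le (hfR.mono (hsub y hy)) (fun z hz => hM z (hsub y hy hz)) hmem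
    rw [add_sub_cancel_left, map_smul] at key
    rw [dist_comm, dist_eq_norm]
    have e1 : s⁻¹ • (f (y + s • w) - f y) - fderiv ℂ f y w =
        s⁻¹ • (f (y + s • w) - f y - s • fderiv ℂ f y w) := by
      rw [smul_sub s⁻¹ _ (s • _), smul_smul, inv_mul_cancel₀ hs0', one_smul]
    rw [e1, norm_smul, norm_inv]
    refine lt_of_le_of_lt ?_ hs
    have hsn : 0 < ‖s‖ := norm_pos_iff.2 hs0'
    calc ‖s‖⁻¹ * ‖f (y + s • w) - f y - s • fderiv ℂ f y w‖
        ≤ ‖s‖⁻¹ * (4 * M * (‖s • w‖ / (R / 2)) ^ 2) := by gcongr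
      _ = ‖s‖ * (4 * M * (‖w‖ / (R / 2)) ^ 2) := by
        rw [norm_smul]; field_simp

end HolomorphicMaps

section UniquenessSets

open Metric

variable {E F V : Type*} [NormedAddCommGroup E] [NormedSpace ℂ E]
  [NormedAddCommGroup F] [NormedSpace ℂ F] [CompleteSpace F]
  [NormedAddCommGroup V] [NormedSpace ℝ V]

/-- A holomorphic map on a ball all of whose iterated directional derivatives vanish at some
point is zero. -/
theorem eq_zero_of_iterate_fderiv_apply_eq_zero {h : E → F} {z a : E} {r : ℝ}
    (hh : DifferentiableOn ℂ h (ball z r)) (ha : a ∈ ball z r)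
    (h0 : ∀ w : E, ∀ k : ℕ, (fun (g : E → F) x => fderiv ℂ g x w)^[k] h a = 0)
    {b : E} (hb : b ∈ ball z r) : h b = 0 := by
  set w := b - a with hw
  set D : (E → F) → E → F := fun g x => fderiv ℂ g x w with hD
  set ℓ : ℂ → E := fun s => a + s • w with hℓ
  set U : Set ℂ := ℓ ⁻¹' ball z r with hU
  have hℓc : Continuous ℓ := by fun_prop
  have hUo : IsOpen U := isOpen_ball.preimage hℓc
  have hℓd : ∀ s, HasDerivAt ℓ w s := fun s => by
    simpa only [one_smul, id] using ((hasDerivAt_id s).smul_const w).const_add a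
  have hk : ∀ k, DifferentiableOn ℂ (D^[k] h) (ball z r) := by
    intro k
    induction k with
    | zero => exact hh
    | succ k ih =>
      rw [Function.iterate_succ_apply']
      exact ih.fderiv_apply_complex isOpen_ball w
  have hder : ∀ k, ∀ s ∈ U, iteratedDeriv k (h ∘ ℓ) s = D^[k] h (ℓ s) := by
    intro k
    induction k with
    | zero => intro s _; simp
    | succ k ih =>
      intro s hs
      rw [iteratedDeriv_succ]
      have e1 : iteratedDeriv k (h ∘ ℓ) =ᶠ[𝓝 s] fun s => D^[k] h (ℓ s) := by
        filter_upwards [hUo.mem_nhds hs] with s' hs' using ih s' hs'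
      rw [e1.deriv_eq, Function.iterate_succ_apply']
      have := ((hk k _ hs).differentiableAt (isOpen_ball.mem_nhds hs)).hasFDerivAt.comp_hasDerivAt
        s (hℓd s)
      exact this.deriv
  have hφ : DifferentiableOn ℂ (h ∘ ℓ) U :=
    hh.comp (fun s _ => (hℓd s).differentiableAt.differentiableWithinAt) fun s hs => hs
  have h0U : (0 : ℂ) ∈ U := by simpa [hU, hℓ] using ha
  have h1U : (1 : ℂ) ∈ U := by simpa [hU, hℓ, hw] using hb
  have hev : (h ∘ ℓ) =ᶠ[𝓝 0] 0 := by
    obtain ⟨ρ, hρ, hρU⟩ := Metric.isOpen_iff.1 hUo 0 h0U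
    filter_upwards [ball_mem_nhds (0 : ℂ) hρ] with s hs
    have hsum := Complex.hasSum_taylorSeries_on_ball (hφ.mono hρU) hs
    have hz : ∀ k, iteratedDeriv k (h ∘ ℓ) 0 = 0 := fun k => by
      rw [hder k 0 h0U]
      simpa [hℓ] using h0 w k
    simp only [hz, smul_zero] at hsum
    exact hsum.unique hasSum_zero
  have hconv : Convex ℝ U := by
    intro s hs t ht p q hp hq hpq
    have := convex_ball z r hs ht hp hq hpq
    have e : ℓ (p • s + q • t) = p • ℓ s + q • ℓ t := by
      simp only [hℓ, smul_add, add_smul]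
      rw [show p • a + p • s • w + (q • a + q • t • w) =
        (p + q) • a + (p • s • w + q • t • w) by rw [add_smul]; abel, hpq, one_smul,
        smul_assoc, smul_assoc]
    rw [hU, mem_preimage, e]
    exact this
  have := (hφ.analyticOnNhd hUo).eqOn_zero_of_preconnected_of_eventuallyEq_zero
    hconv.isPreconnected h0U hev h1U
  simpa [hℓ, hw] using this

/-- A holomorphic map vanishing along a real submanifold whose tangent spaces generate the whole
complex vector space is zero. -/
theorem eq_zero_of_comp_eq_zero_of_span_eq_top {W : Set V} (hW : IsOpen W) {c : V → E}
    (hc : ∀ x ∈ W, DifferentiableAt ℝ c x)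
    (hspan : ∀ x ∈ W, Submodule.span ℂ (range (fderiv ℝ c x)) = ⊤) {h : E → F} {z : E} {r : ℝ}
    (hh : DifferentiableOn ℂ h (ball z r)) (h0 : ∀ x ∈ W, c x ∈ ball z r → h (c x) = 0)
    (hne : ∃ x ∈ W, c x ∈ ball z r) {b : E} (hb : b ∈ ball z r) : h b = 0 := by
  obtain ⟨x, hx, hxr⟩ := hne
  refine eq_zero_of_iterate_fderiv_apply_eq_zero hh hxr (fun w k => ?_) hb
  set D : (E → F) → E → F := fun g x => fderiv ℂ g x w with hD
  have hstep : ∀ k, DifferentiableOn ℂ (D^[k] h) (ball z r) ∧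
      ∀ x ∈ W, c x ∈ ball z r → D^[k] h (c x) = 0 := by
    intro k
    induction k with
    | zero => exact ⟨hh, h0⟩
    | succ k ih =>
      rw [Function.iterate_succ_apply']
      refine ⟨ih.1.fderiv_apply_complex isOpen_ball w, fun x hx hxr => ?_⟩
      have hg : HasFDerivAt (D^[k] h) (fderiv ℂ (D^[k] h) (c x)) (c x) :=
        ((ih.1 _ hxr).differentiableAt (isOpen_ball.mem_nhds hxr)).hasFDerivAt
      have hcomp := (hg.restrictScalars ℝ).comp x (hc x hx).hasFDerivAt
      have hzero : (D^[k] h) ∘ c =ᶠ[𝓝 x] fun _ => 0 := by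
        filter_upwards [hW.mem_nhds hx,
          (hc x hx).continuousAt.eventually (isOpen_ball.mem_nhds hxr)] with y hy hyr
        exact ih.2 y hy hyr
      have heq := (hcomp.congr_of_eventuallyEq hzero.symm).unique (hasFDerivAt_const 0 x)
      have hker : Submodule.span ℂ (range (fderiv ℝ c x)) ≤
          LinearMap.ker (fderiv ℂ (D^[k] h) (c x)).toLinearMap := by
        rw [Submodule.span_le]
        rintro _ ⟨v, rfl⟩
        simpa using congrArg (fun L => L v) heq
      rw [hspan x hx] at hker
      exact hker (Submodule.mem_top (x := w))
  exact (hstep k).2 x hx hxr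

end UniquenessSets

/-- The lattice `ℤ + ℤ i`. -/
def squareLattice : AddSubgroup ℂ where
  carrier := {z | ∃ m k : ℤ, z = m + k * I}
  zero_mem' := ⟨0, 0, by simp⟩
  add_mem' := by
    rintro _ _ ⟨m, k, rfl⟩ ⟨m', k', rfl⟩
    exact ⟨m + m', k + k', by push_cast; ring⟩
  neg_mem' := by
    rintro _ ⟨m, k, rfl⟩
    exact ⟨-m, -k, by push_cast; ring⟩

section QuasiPeriodicCocycles

open Metric

variable {E ι : Type*} [NormedAddCommGroup E] [NormedSpace ℂ E]

/-- The family `v` of maps on the discs `ball (p i) (2 * ρ i)` jumps, up to `ε`, by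
`(ζ - ζ').im • σ` when passing from `ζ` to the congruent point `ζ'`. -/
def JumpBound (p : ι → ℂ) (ρ : ι → ℝ) (v : ι → ℂ → E) (σ : E) (ε : ℝ) : Prop :=
  ∀ i j, ∀ ζ ∈ ball (p i) (2 * ρ i), ∀ ζ' ∈ ball (p j) (2 * ρ j), ζ - ζ' ∈ squareLattice →
    ‖v j ζ' - v i ζ - ((ζ - ζ').im : ℂ) • σ‖ ≤ ε

theorem eq_zero_of_jumpBound_zero [CompleteSpace E] {p : ι → ℂ} {ρ : ι → ℝ}
    (hcov : ∀ ζ : ℂ, ∃ i, ∃ ζ' ∈ ball (p i) (ρ i), ζ - ζ' ∈ squareLattice) [Finite ι] {i₀ : ι}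
    (hρ : ∀ i, 0 < ρ i) {v : ι → ℂ → E} {σ : E}
    (hv : ∀ i, DifferentiableOn ℂ (v i) (ball (p i) (2 * ρ i))) (hv0 : v i₀ (p i₀) = 0)
    (hj : JumpBound p ρ v σ 0) : σ = 0 ∧ ∀ i, ∀ ζ ∈ ball (p i) (2 * ρ i), v i ζ = 0 := by
  have hsub : ∀ i, ball (p i) (ρ i) ⊆ ball (p i) (2 * ρ i) := fun i =>
    ball_subset_ball (by linarith [hρ i])
  choose J r hr hJ using hcov
  set f : ℂ → E := fun ζ => v (J ζ) (r ζ) - ((ζ - r ζ).im : ℂ) • σ with hf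
  have hjump : ∀ i j, ∀ ζ ∈ ball (p i) (2 * ρ i), ∀ ζ' ∈ ball (p j) (2 * ρ j),
      ζ - ζ' ∈ squareLattice → v j ζ' = v i ζ + ((ζ - ζ').im : ℂ) • σ := by
    intro i j ζ hζ ζ' hζ' hL
    have := norm_le_zero_iff.1 (hj i j ζ hζ ζ' hζ' hL)
    rw [sub_sub, sub_eq_zero] at this
    exact this
  have hindep : ∀ i ζ ζ', ζ' ∈ ball (p i) (2 * ρ i) → ζ - ζ' ∈ squareLattice →
      f ζ = v i ζ' - ((ζ - ζ').im : ℂ) • σ := by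
    intro i ζ ζ' hζ' hL
    have h1 : ζ' - r ζ ∈ squareLattice := by
      have := squareLattice.sub_mem (hJ ζ) hL
      simpa using this
    have := hjump i (J ζ) ζ' hζ' (r ζ) (hsub _ (hr ζ)) h1
    simp only [hf]
    rw [this]
    simp only [sub_im, ofReal_sub, sub_smul]
    abel
  have hdiff : Differentiable ℂ f := by
    intro ζ
    have h1 : f =ᶠ[𝓝 ζ] fun ξ => v (J ζ) (ξ - (ζ - r ζ)) - ((ζ - r ζ).im : ℂ) • σ := by
      have hc : Continuous fun ξ : ℂ => ξ - (ζ - r ζ) := by fun_prop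
      have hmem : ζ - (ζ - r ζ) ∈ ball (p (J ζ)) (2 * ρ (J ζ)) := by simpa using hsub _ (hr ζ)
      filter_upwards [hc.continuousAt.eventually (isOpen_ball.mem_nhds hmem)] with ξ hξ
      rw [hindep (J ζ) ξ (ξ - (ζ - r ζ)) hξ (by simpa using hJ ζ)]
      simp
    refine DifferentiableAt.congr_of_eventuallyEq ?_ h1
    refine DifferentiableAt.sub_const ?_ _
    have h2 : DifferentiableAt ℂ (v (J ζ)) (ζ - (ζ - r ζ)) := by
      rw [sub_sub_cancel]
      exact (hv _ _ (hsub _ (hr ζ))).differentiableAt (isOpen_ball.mem_nhds (hsub _ (hr ζ)))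
    exact h2.comp ζ (differentiableAt_id.sub_const (ζ - r ζ))
  have hquasi : ∀ ζ, ∀ l ∈ squareLattice, f (ζ + l) = f ζ - (l.im : ℂ) • σ := by
    intro ζ l hl
    have h1 : ζ + l - r ζ ∈ squareLattice := by
      have := squareLattice.add_mem (hJ ζ) hl
      rwa [show ζ + l - r ζ = ζ - r ζ + l by ring]
    rw [hindep (J ζ) (ζ + l) (r ζ) (hsub _ (hr ζ)) h1]
    simp only [hf, sub_im, add_im, ofReal_sub, ofReal_add, sub_smul, add_smul]
    abel
  have hper : ∀ ζ, ∀ l ∈ squareLattice, deriv f (ζ + l) = deriv f ζ := by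
    intro ζ l hl
    have h1 : (fun ξ => f (ξ + l)) = fun ξ => f ξ - (l.im : ℂ) • σ :=
      funext fun ξ => hquasi ξ l hl
    rw [← deriv_comp_add_const, h1, deriv_sub_const]
  have hderiv_diff : Differentiable ℂ (deriv f) := fun ζ =>
    (hdiff.analyticAt ζ).deriv.differentiableAt
  have hbdd : Bornology.IsBounded (range (deriv f)) := by
    have h1 : range (deriv f) ⊆ ⋃ i, deriv f '' closedBall (p i) (ρ i) := by
      rintro _ ⟨ζ, rfl⟩
      refine mem_iUnion.2 ⟨J ζ, r ζ, ball_subset_closedBall (hr ζ), ?_⟩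
      have := hper (r ζ) _ (hJ ζ)
      rwa [add_sub_cancel, eq_comm] at this
    refine Bornology.IsBounded.subset ?_ h1
    refine (Bornology.isBounded_iUnion).2 fun i => ?_
    exact ((isCompact_closedBall _ _).image hderiv_diff.continuous).isBounded
  have hconst : ∀ ζ, deriv f ζ = deriv f 0 := fun ζ =>
    hderiv_diff.apply_eq_apply_of_bounded hbdd ζ 0
  have haff : ∀ ζ, f ζ = f 0 + ζ • deriv f 0 := by
    have h1 : ∀ ζ, HasDerivAt (fun ζ => f ζ - ζ • deriv f 0) 0 ζ := fun ζ => by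
      have h := (hdiff ζ).hasDerivAt.sub ((hasDerivAt_id ζ).smul_const (deriv f 0))
      rw [hconst ζ, one_smul, sub_self] at h
      exact h
    intro ζ
    have := is_const_of_deriv_eq_zero (fun ζ => (h1 ζ).differentiableAt)
      (fun ζ => (h1 ζ).deriv) ζ 0
    rw [zero_smul, sub_zero, sub_eq_iff_eq_add] at this
    exact this
  have hα : deriv f 0 = 0 := by
    have h1 := hquasi 0 1 ⟨1, 0, by simp⟩
    rw [zero_add, haff 1] at h1
    simpa using h1
  have hσ : σ = 0 := by
    have h1 := hquasi 0 I ⟨0, 1, by simp⟩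
    rw [zero_add, haff I, hα] at h1
    simpa [eq_sub_iff_add_eq] using h1
  refine ⟨hσ, fun i ζ hζ => ?_⟩
  have hfv : ∀ i, ∀ ζ ∈ ball (p i) (2 * ρ i), f ζ = v i ζ := fun i ζ hζ => by
    rw [hindep i ζ ζ hζ (by simp)]; simp
  have h2 : f (p i₀) = 0 := by
    rw [hfv i₀ _ (mem_ball_self (by linarith [hρ i₀])), hv0]
  rw [haff, hα, smul_zero, add_zero] at h2
  rw [← hfv i ζ hζ, haff ζ, hα, smul_zero, h2, add_zero]

/-- Pointwise convergent bounded families of holomorphic maps on an open subset of `ℂ` converge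
locally uniformly. -/
theorem tendstoLocallyUniformlyOn_of_norm_le {α : Type*} {l : Filter α} [l.NeBot]
    {f : α → ℂ → E} {g : ℂ → E} {U : Set ℂ} (hU : IsOpen U) {M : ℝ}
    (hf : ∀ a, DifferentiableOn ℂ (f a) U) (hM : ∀ a, ∀ z ∈ U, ‖f a z‖ ≤ M)
    (hfg : ∀ z ∈ U, Tendsto (fun a => f a z) l (𝓝 (g z))) : TendstoLocallyUniformlyOn f g l U := by
  rw [Metric.tendstoLocallyUniformlyOn_iff]
  intro ε hε z hz
  obtain ⟨R, hR, hRU⟩ := Metric.isOpen_iff.1 hU z hz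
  obtain ⟨a₀⟩ : Nonempty α := l.nonempty_of_neBot
  have hM0 : 0 ≤ M := (norm_nonneg _).trans (hM a₀ z hz)
  have hball : ∀ w ∈ ball z R, ∀ a, ‖f a w - f a z‖ ≤ 2 * M / R * ‖w - z‖ := by
    intro w hw a
    have := Complex.dist_le_div_mul_dist_of_mapsTo_ball (c := z) (R₁ := R) (R₂ := 2 * M)
      ((hf a).mono hRU) (fun y hy => ?_) hw
    · simpa [dist_eq_norm] using this
    · rw [mem_closedBall, dist_eq_norm]
      linarith [norm_sub_le (f a y) (f a z), hM a y (hRU hy), hM a z hz]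
  have hlim : ∀ w ∈ ball z R, ‖g w - g z‖ ≤ 2 * M / R * ‖w - z‖ := fun w hw =>
    le_of_tendsto ((hfg w (hRU hw)).sub (hfg z hz)).norm
      (Eventually.of_forall fun a => hball w hw a)
  have hsmall : ∀ᶠ w in 𝓝 z, 2 * M / R * ‖w - z‖ < ε / 3 := by
    have hc : Continuous fun w => 2 * M / R * ‖w - z‖ := by fun_prop
    have := hc.tendsto z
    rw [sub_self, norm_zero, mul_zero] at this
    exact this.eventually (gt_mem_nhds (by positivity))
  refine ⟨ball z R ∩ {w | 2 * M / R * ‖w - z‖ < ε / 3}, mem_nhdsWithin_of_mem_nhds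
    (inter_mem (ball_mem_nhds z hR) hsmall), ?_⟩
  filter_upwards [(Metric.tendsto_nhds.1 (hfg z hz)) (ε / 3) (by positivity)] with a ha w hw
  have h1 := hball w hw.1 a
  have h2 := hlim w hw.1
  rw [dist_eq_norm] at ha ⊢
  have e : g w - f a w = (g w - g z) - (f a w - f a z) - (f a z - g z) := by abel
  rw [e]
  have h3 := norm_sub_le ((g w - g z) - (f a w - f a z)) (f a z - g z)
  have h4 := norm_sub_le (g w - g z) (f a w - f a z)
  have h5 : 2 * M / R * ‖w - z‖ < ε / 3 := hw.2
  linarith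

theorem exists_halving_of_jumpBound [ProperSpace E] [Finite ι] {p : ι → ℂ} {ρ : ι → ℝ} {i₀ : ι}
    (hcov : ∀ ζ : ℂ, ∃ i, ∃ ζ' ∈ ball (p i) (ρ i), ζ - ζ' ∈ squareLattice) (hρ : ∀ i, 0 < ρ i) :
    ∃ ε > 0, ∀ (v : ι → ℂ → E) (σ : E),
      (∀ i, DifferentiableOn ℂ (v i) (ball (p i) (2 * ρ i))) → v i₀ (p i₀) = 0 →
      (∀ i, ∀ ζ ∈ ball (p i) (2 * ρ i), ‖v i ζ‖ ≤ 1) → ‖σ‖ ≤ 1 → JumpBound p ρ v σ ε →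
      (∀ i, ∀ ζ ∈ ball (p i) (2 * ρ i), ‖v i ζ‖ ≤ 1 / 2) ∧ ‖σ‖ ≤ 1 / 2 := by
  by_contra! hcon
  have hpos : ∀ n : ℕ, (0 : ℝ) < 1 / (n + 1) := fun n => by positivity
  choose v σ hv hv0 hv1 hσ1 hjb hnot using fun n : ℕ => hcon (1 / (n + 1)) (hpos n)
  set l : Filter ℕ := (hyperfilter ℕ : Filter ℕ) with hl
  have hlim : ∀ u : ℕ → E, (∀ n, ‖u n‖ ≤ 1) → ∃ a, Tendsto u l (𝓝 a) := by
    intro u hu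
    obtain ⟨a, -, ha⟩ := (isCompact_closedBall (0 : E) 1).ultrafilter_le_nhds
      ((hyperfilter ℕ).map u) (le_principal_iff.2 (Filter.mem_map.2
        (Filter.univ_mem' fun n => by simpa using hu n)))
    exact ⟨a, ha⟩
  obtain ⟨σ', hσ'⟩ := hlim σ hσ1
  choose! v' hv' using fun i ζ (hζ : ζ ∈ ball (p i) (2 * ρ i)) =>
    hlim (fun n => v n i ζ) fun n => hv1 n i ζ hζ
  have htend : Tendsto (fun n : ℕ => (1 : ℝ) / (n + 1)) l (𝓝 0) :=
    tendsto_one_div_add_atTop_nhds_zero_nat.mono_left Nat.hyperfilter_le_atTop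
  have hloc : ∀ i, TendstoLocallyUniformlyOn (fun n => v n i) (v' i) l (ball (p i) (2 * ρ i)) :=
    fun i => tendstoLocallyUniformlyOn_of_norm_le isOpen_ball (fun n => hv n i)
      (fun n => hv1 n i) (hv' i)
  have hmem : ∀ i, p i ∈ ball (p i) (2 * ρ i) := fun i => mem_ball_self (by linarith [hρ i])
  obtain ⟨hσz, hvz⟩ := eq_zero_of_jumpBound_zero (i₀ := i₀) (v := v') (σ := σ') hcov hρ
    (fun i => (hloc i).differentiableOn (Eventually.of_forall fun n => hv n i) isOpen_ball)
    (tendsto_nhds_unique (hv' i₀ _ (hmem i₀)) (by simp [hv0]))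
    (fun i j ζ hζ ζ' hζ' hL => le_of_tendsto_of_tendsto
      (((hv' j ζ' hζ').sub (hv' i ζ hζ)).sub (hσ'.const_smul _)).norm htend
      (Eventually.of_forall fun n => hjb n i j ζ hζ ζ' hζ' hL))
  have hcore : ∀ i, ∀ᶠ n in l, ∀ ζ ∈ closedBall (p i) (ρ i), ‖v n i ζ‖ < 1 / 8 := by
    intro i
    have hsub : closedBall (p i) (ρ i) ⊆ ball (p i) (2 * ρ i) :=
      closedBall_subset_ball (by linarith [hρ i])
    have := (tendstoLocallyUniformlyOn_iff_tendstoUniformlyOn_of_compact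
      (isCompact_closedBall (p i) (ρ i))).1 ((hloc i).mono hsub)
    filter_upwards [(Metric.tendstoUniformlyOn_iff.1 this) (1 / 8) (by norm_num)] with n hn ζ hζ
    have := hn ζ hζ
    rwa [hvz i ζ (hsub hζ), dist_zero_left] at this
  obtain ⟨D, hD⟩ : ∃ D : ℝ, ∀ i, ∀ ζ ∈ ball (p i) (2 * ρ i), ‖ζ‖ ≤ D := by
    have : Bornology.IsBounded (⋃ i, ball (p i) (2 * ρ i)) :=
      Bornology.isBounded_iUnion.2 fun i => isBounded_ball
    obtain ⟨D, hD⟩ := this.exists_norm_le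
    exact ⟨D, fun i ζ hζ => hD ζ (mem_iUnion.2 ⟨i, hζ⟩)⟩
  have hD0 : 0 ≤ D := (norm_nonneg _).trans (hD i₀ _ (hmem i₀))
  have hσn : ∀ᶠ n in l, (2 * D + 1) * ‖σ n‖ < 1 / 8 := by
    have := (hσ'.norm.const_mul (2 * D + 1))
    rw [hσz, norm_zero, mul_zero] at this
    exact this.eventually (gt_mem_nhds (by norm_num))
  have hεn : ∀ᶠ n : ℕ in l, (1 : ℝ) / (n + 1) < 1 / 8 :=
    htend.eventually (gt_mem_nhds (by norm_num))
  obtain ⟨n, hn1, hn2, hn3⟩ := ((eventually_all.2 hcore).and (hσn.and hεn)).exists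
  have hσ0 := norm_nonneg (σ n)
  refine (hnot n ?_).not_ge ?_
  · intro j ζ' hζ'
    obtain ⟨i, ζ, hζ, hL⟩ := hcov ζ'
    have hL' : ζ - ζ' ∈ squareLattice := by simpa using squareLattice.neg_mem hL
    have hζ2 : ζ ∈ ball (p i) (2 * ρ i) := ball_subset_ball (by linarith [hρ i]) hζ
    have h1 := hjb n i j ζ hζ2 ζ' hζ' hL'
    have h2 := hn1 i ζ (ball_subset_closedBall hζ)
    have h3 : ‖((ζ - ζ').im : ℂ) • σ n‖ ≤ (2 * D + 1) * ‖σ n‖ := by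
      rw [norm_smul, Complex.norm_real]
      gcongr
      calc ‖(ζ - ζ').im‖ ≤ ‖ζ - ζ'‖ := Complex.abs_im_le_norm _
        _ ≤ ‖ζ‖ + ‖ζ'‖ := norm_sub_le _ _
        _ ≤ 2 * D + 1 := by linarith [hD i ζ hζ2, hD j ζ' hζ']
    have e : v n j ζ' = (v n j ζ' - v n i ζ - ((ζ - ζ').im : ℂ) • σ n) + v n i ζ
      + ((ζ - ζ').im : ℂ) • σ n := by abel
    rw [e]
    refine (norm_add₃_le).trans ?_
    linarith
  · nlinarith

/-- A priori estimate: a family of bounded holomorphic maps, normalised at one point, is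
controlled by its jumps along the square torus. -/
theorem exists_le_of_jumpBound [ProperSpace E] [Finite ι] {p : ι → ℂ} {ρ : ι → ℝ} {i₀ : ι}
    (hcov : ∀ ζ : ℂ, ∃ i, ∃ ζ' ∈ ball (p i) (ρ i), ζ - ζ' ∈ squareLattice) (hρ : ∀ i, 0 < ρ i) :
    ∃ C > 0, ∀ (v : ι → ℂ → E) (σ : E) (ε M : ℝ),
      (∀ i, DifferentiableOn ℂ (v i) (ball (p i) (2 * ρ i))) → v i₀ (p i₀) = 0 →
      (∀ i, ∀ ζ ∈ ball (p i) (2 * ρ i), ‖v i ζ‖ ≤ M) → JumpBound p ρ v σ ε →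
      (∀ i, ∀ ζ ∈ ball (p i) (2 * ρ i), ‖v i ζ‖ ≤ C * ε) ∧ ‖σ‖ ≤ C * ε := by
  obtain ⟨ε₀, hε₀, H⟩ := exists_halving_of_jumpBound (E := E) (i₀ := i₀) hcov hρ
  refine ⟨ε₀⁻¹, by positivity, fun v σ ε M hv hv0 hM hj => ?_⟩
  have hmem : p i₀ ∈ ball (p i₀) (2 * ρ i₀) := mem_ball_self (by linarith [hρ i₀])
  have hε : 0 ≤ ε := (norm_nonneg _).trans (hj i₀ i₀ _ hmem _ hmem (by simp))
  set B : ℝ → Prop := fun q => (∀ i, ∀ ζ ∈ ball (p i) (2 * ρ i), ‖v i ζ‖ ≤ q) ∧ ‖σ‖ ≤ q with hB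
  have hmono : ∀ q q', q ≤ q' → B q → B q' := fun q q' h hq =>
    ⟨fun i ζ hζ => (hq.1 i ζ hζ).trans h, hq.2.trans h⟩
  have hhalf : ∀ q, 0 < q → ε ≤ ε₀ * q → B q → B (q / 2) := by
    intro q hq hεq hb
    have hn : ∀ x : E, ‖((q⁻¹ : ℝ) : ℂ) • x‖ = q⁻¹ * ‖x‖ := fun x => by
      rw [norm_smul, Complex.norm_real, Real.norm_of_nonneg (by positivity)]
    have hle : ∀ (x : E) (t : ℝ), ‖x‖ ≤ q * t → ‖((q⁻¹ : ℝ) : ℂ) • x‖ ≤ t := fun x t h => by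
      rw [hn, inv_mul_le_iff₀ hq]; exact h
    have hge : ∀ (x : E) (t : ℝ), ‖((q⁻¹ : ℝ) : ℂ) • x‖ ≤ t → ‖x‖ ≤ q * t := fun x t h => by
      rwa [hn, inv_mul_le_iff₀ hq] at h
    have := H (fun i ζ => ((q⁻¹ : ℝ) : ℂ) • v i ζ) (((q⁻¹ : ℝ) : ℂ) • σ)
      (fun i => (hv i).const_smul _) (by simp [hv0])
      (fun i ζ hζ => hle _ _ (by simpa using hb.1 i ζ hζ)) (hle _ _ (by simpa using hb.2))
      (fun i j ζ hζ ζ' hζ' hL => by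
        have h1 := (hj i j ζ hζ ζ' hζ' hL).trans hεq
        rw [smul_comm _ _ σ, ← smul_sub, ← smul_sub]
        exact hle _ _ (by linarith))
    exact ⟨fun i ζ hζ => (hge _ _ (this.1 i ζ hζ)).trans_eq (by ring),
      (hge _ _ this.2).trans_eq (by ring)⟩
  -- `B` holds for every `q` above the threshold
  have hq : ∀ q, 0 < q → ε ≤ ε₀ * q → B q := by
    intro q hq0 hqε
    set q₀ : ℝ := max q (max M ‖σ‖) with hq₀
    have hb₀ : B q₀ := ⟨fun i ζ hζ => (hM i ζ hζ).trans (by simp [hq₀]), by simp [hq₀]⟩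
    by_contra hnb
    have hall : ∀ k : ℕ, B (q₀ / 2 ^ k) ∧ q ≤ q₀ / 2 ^ k := by
      intro k
      induction k with
      | zero => exact ⟨by simpa using hb₀, by simp [hq₀]⟩
      | succ k ih =>
        have h1 := hhalf _ (hq0.trans_le ih.2)
          (hqε.trans (mul_le_mul_of_nonneg_left ih.2 hε₀.le)) ih.1
        rw [div_div, ← pow_succ] at h1
        exact ⟨h1, le_of_not_ge fun h => hnb (hmono _ _ h h1)⟩
    have ht : Tendsto (fun k : ℕ => q₀ / 2 ^ k) atTop (𝓝 0) :=
      tendsto_const_nhds.div_atTop (tendsto_pow_atTop_atTop_of_one_lt (by norm_num))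
    exact hq0.not_ge (ge_of_tendsto ht (Eventually.of_forall fun k => (hall k).2))
  have hlim : ∀ η > 0, B (ε₀⁻¹ * ε + η) := fun η hη => hq _ (by positivity) (by
    rw [mul_add, mul_inv_cancel_left₀ hε₀.ne']
    nlinarith)
  exact ⟨fun i ζ hζ => le_of_forall_pos_le_add fun η hη => (hlim η hη).1 i ζ hζ,
    le_of_forall_pos_le_add fun η hη => (hlim η hη).2⟩

end QuasiPeriodicCocycles

section ImplicitEquation

open Metric BoundedContinuousFunction

open scoped NNReal

/-- The equation `v - T v = a` is solved near `0` by a holomorphic map when `T` is holomorphic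
near `0` and tangent to zero. -/
theorem exists_holomorphic_localInverse_sub {A : Type*} [NormedAddCommGroup A] [NormedSpace ℂ A]
    [CompleteSpace A] {T : A → A} (hT : HasStrictFDerivAt T (0 : A →L[ℂ] A) 0)
    (hd : ∀ᶠ v in 𝓝 0, DifferentiableAt ℂ T v) (hT0 : T 0 = 0) :
    ∃ G : A → A, Tendsto G (𝓝 0) (𝓝 0) ∧ (∀ᶠ a in 𝓝 0, DifferentiableAt ℂ G a) ∧
      (∀ᶠ a in 𝓝 0, G a - T (G a) = a) ∧ ∀ᶠ v in 𝓝 0, G (v - T v) = v := by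
  have hΘ : HasStrictFDerivAt (fun v => v - T v)
      ((ContinuousLinearEquiv.refl ℂ A : A ≃L[ℂ] A) : A →L[ℂ] A) 0 := by
    have h := (hasStrictFDerivAt_id (𝕜 := ℂ) (0 : A)).sub hT
    rw [sub_zero] at h
    exact h
  have hΘ0 : (0 : A) - T 0 = 0 := by simp [hT0]
  have htend : Tendsto (hΘ.localInverse _ _ _) (𝓝 0) (𝓝 0) := by
    have := hΘ.localInverse_tendsto
    simp only [hΘ0] at this
    exact this
  have hright := hΘ.eventually_right_inverse
  simp only [hΘ0] at hright
  refine ⟨hΘ.localInverse _ _ _, htend, ?_, hright, hΘ.eventually_left_inverse⟩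
  have hsmall : ∀ᶠ v in 𝓝 (0 : A), ‖fderiv ℂ T v‖ < 1 := by
    obtain ⟨s, hs, hlip⟩ := hT.exists_lipschitzOnWith_of_nnnorm_lt (1 / 2) (by simp)
    filter_upwards [eventually_mem_nhds_iff.2 hs] with v hv
    exact (norm_fderiv_le_of_lipschitzOn ℂ hv hlip).trans_lt (by norm_num)
  have htar : ∀ᶠ a in 𝓝 (0 : A), a ∈ (hΘ.toOpenPartialHomeomorph _).target := by
    have h := (hΘ.toOpenPartialHomeomorph _).open_target.mem_nhds
      hΘ.image_mem_toOpenPartialHomeomorph_target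
    simp only [hΘ0] at h
    exact h
  filter_upwards [htar, htend.eventually hd, htend.eventually hsmall] with a ha hda hsa
  set v := hΘ.localInverse _ _ _ a with hv
  have hder : HasFDerivAt (fun v => v - T v)
      ((ContinuousLinearEquiv.unitsEquiv ℂ A (Units.oneSub _ hsa) : A ≃L[ℂ] A) : A →L[ℂ] A) v := by
    have h := (hasFDerivAt_id (𝕜 := ℂ) v).sub hda.hasFDerivAt
    exact h
  exact ((hΘ.toOpenPartialHomeomorph _).hasFDerivAt_symm ha hder).differentiableAt

variable {Y J E : Type*} [TopologicalSpace Y] [TopologicalSpace J]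
  [NormedAddCommGroup E] [NormedSpace ℂ E]

/-- A uniformly bounded family of holomorphic maps tangent to zero at the origin induces
a superposition operator between spaces of bounded functions which is holomorphic near `0`
and tangent to zero. -/
theorem exists_superposition [DiscreteTopology J] (src : J → Y) {n : J → E → E} {ρ B : ℝ} (hρ : 0 < ρ)
    (hB0 : 0 ≤ B)
    (hn : ∀ j, DifferentiableOn ℂ (n j) (ball 0 ρ)) (hB : ∀ j, ∀ x ∈ ball 0 ρ, ‖n j x‖ ≤ B)
    (hn0 : ∀ j, n j 0 = 0) (hn1 : ∀ j, fderiv ℂ (n j) 0 = 0) :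
    ∃ N : (Y →ᵇ E) → (J →ᵇ E), (∀ v, ‖v‖ < ρ → ∀ j, N v j = n j (v (src j))) ∧
      HasStrictFDerivAt N (0 : (Y →ᵇ E) →L[ℂ] (J →ᵇ E)) 0 ∧
      ∀ᶠ v in 𝓝 0, DifferentiableAt ℂ N v := by
  classical
  have hb : ∀ (v : Y →ᵇ E) j, ‖if ‖v (src j)‖ < ρ then n j (v (src j)) else 0‖ ≤ B := by
    intro v j
    split_ifs with h
    · exact hB j _ (by simpa using h)
    · simpa using hB0
  set N : (Y →ᵇ E) → (J →ᵇ E) := fun v =>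
    ofNormedAddCommGroupDiscrete (fun j => if ‖v (src j)‖ < ρ then n j (v (src j)) else 0) B (hb v)
    with hN
  have hNv : ∀ v, ‖v‖ < ρ → ∀ j, N v j = n j (v (src j)) := by
    intro v hv j
    have : ‖v (src j)‖ < ρ := (v.norm_coe_le_norm _).trans_lt hv
    simp [hN, this]
  refine ⟨N, hNv, ?_, ?_⟩
  · -- small Lipschitz constants near the origin
    have hquad : ∀ j, ∀ x ∈ ball (0 : E) ρ, ‖n j x‖ ≤ 4 * B * (‖x‖ / ρ) ^ 2 := by
      intro j x hx
      simpa [hn0, hn1] using norm_sub_sub_fderiv_le (hn j) (hB j) hx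
    have hder : ∀ r, 0 < r → r ≤ ρ / 2 → ∀ j, ∀ x ∈ ball (0 : E) r,
        ‖fderiv ℂ (n j) x‖ ≤ 32 * B / ρ ^ 2 * r := by
      intro r hr hrρ j x hx
      have hsub : ball x r ⊆ ball 0 (2 * r) :=
        ball_subset_ball' (by have := mem_ball.1 hx; linarith)
      have hsub' : ball (0 : E) (2 * r) ⊆ ball 0 ρ := ball_subset_ball (by linarith)
      refine (norm_fderiv_le_of_norm_le_ball (M := 4 * B * (2 * r / ρ) ^ 2) hr
        ((hn j).mono (hsub.trans hsub')) fun y hy => ?_).trans_eq ?_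
      · refine (hquad j y (hsub' (hsub hy))).trans ?_
        have : ‖y‖ ≤ 2 * r := by simpa using (mem_ball.1 (hsub hy)).le
        gcongr
      · field_simp
        ring
    refine HasStrictFDerivAt.of_isLittleO ?_
    rw [Asymptotics.isLittleO_iff]
    intro ε hε
    obtain ⟨r, hr, hrρ, hrε⟩ : ∃ r, 0 < r ∧ r ≤ ρ / 2 ∧ 32 * B / ρ ^ 2 * r ≤ ε := by
      refine ⟨min (ρ / 2) (ε / (32 * B / ρ ^ 2 + 1)), by positivity, min_le_left _ _, ?_⟩
      calc 32 * B / ρ ^ 2 * min (ρ / 2) (ε / (32 * B / ρ ^ 2 + 1))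
          ≤ (32 * B / ρ ^ 2 + 1) * (ε / (32 * B / ρ ^ 2 + 1)) := by
            gcongr
            · linarith
            · exact min_le_right _ _
        _ = ε := by field_simp
    have hball : ball (0 : Y →ᵇ E) r ×ˢ ball (0 : Y →ᵇ E) r ∈ 𝓝 ((0 : Y →ᵇ E), (0 : Y →ᵇ E)) :=
      prod_mem_nhds (ball_mem_nhds 0 hr) (ball_mem_nhds 0 hr)
    filter_upwards [hball] with p hp
    have h1 : ‖p.1‖ < r := by simpa using hp.1
    have h2 : ‖p.2‖ < r := by simpa using hp.2
    simp only [zero_apply, sub_zero]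
    rw [BoundedContinuousFunction.norm_le (by positivity)]
    intro j
    have hp1 : p.1 (src j) ∈ ball (0 : E) r := by
      simpa using (p.1.norm_coe_le_norm _).trans_lt h1
    have hp2 : p.2 (src j) ∈ ball (0 : E) r := by
      simpa using (p.2.norm_coe_le_norm _).trans_lt h2
    rw [BoundedContinuousFunction.sub_apply, hNv _ (by linarith), hNv _ (by linarith)]
    refine ((convex_ball (0 : E) r).norm_image_sub_le_of_norm_fderiv_le (𝕜 := ℂ)
      (fun x hx => ?_) (hder r hr hrρ j) hp2 hp1).trans ?_
    · have hx' : x ∈ ball (0 : E) ρ := ball_subset_ball (by linarith) hx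
      exact (hn j x hx').differentiableAt (isOpen_ball.mem_nhds hx')
    · have := (p.1 - p.2).norm_coe_le_norm (src j)
      rw [BoundedContinuousFunction.sub_apply] at this
      gcongr
  · filter_upwards [ball_mem_nhds (0 : Y →ᵇ E) (show 0 < ρ / 2 by positivity)] with v hv
    have hv' : ‖v‖ < ρ / 2 := by simpa using hv
    have hsub : ∀ j, ball (v (src j)) (ρ / 2) ⊆ ball 0 ρ := fun j => ball_subset_ball' (by
      have := (v.norm_coe_le_norm (src j)).trans_lt hv'
      rw [dist_zero_right]
      linarith)
    have hM : ∀ j, ‖fderiv ℂ (n j) (v (src j))‖ ≤ 2 * B / (ρ / 2) := fun j =>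
      norm_fderiv_le_of_norm_le_ball (by positivity) ((hn j).mono (hsub j))
        fun y hy => hB j y (hsub j hy)
    have hbd : ∀ (w : Y →ᵇ E) j, ‖fderiv ℂ (n j) (v (src j)) (w (src j))‖ ≤
        2 * B / (ρ / 2) * ‖w‖ := fun w j =>
      (ContinuousLinearMap.le_opNorm _ _).trans
        (mul_le_mul (hM j) (w.norm_coe_le_norm _) (norm_nonneg _) (by positivity))
    let L : (Y →ᵇ E) →L[ℂ] (J →ᵇ E) := LinearMap.mkContinuous
      { toFun := fun w => ofNormedAddCommGroupDiscrete
          (fun j => fderiv ℂ (n j) (v (src j)) (w (src j))) _ (hbd w)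
        map_add' := fun w w' => by ext j; simp
        map_smul' := fun t w => by ext j; simp } (2 * B / (ρ / 2)) (fun w => by
          rw [BoundedContinuousFunction.norm_le (by positivity)]
          exact hbd w)
    have hL : HasFDerivAt N L v := by
      rw [hasFDerivAt_iff_isLittleO]
      have hO : (fun w => N w - N v - L (w - v)) =O[𝓝 v] fun w => ‖w - v‖ ^ 2 := by
        refine Asymptotics.IsBigO.of_bound (4 * B / (ρ / 2) ^ 2) ?_
        have h1 : ∀ᶠ w in 𝓝 v, w ∈ ball (0 : Y →ᵇ E) (ρ / 2) := isOpen_ball.mem_nhds hv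
        have h2 : ∀ᶠ w in 𝓝 v, w ∈ ball v (ρ / 2) := ball_mem_nhds v (by positivity)
        filter_upwards [h1, h2] with w hw hwv
        have hw' : ‖w‖ < ρ / 2 := by simpa using hw
        have hwv' : ‖w - v‖ < ρ / 2 := by simpa [dist_eq_norm] using hwv
        rw [BoundedContinuousFunction.norm_le (by positivity)]
        intro j
        have hj : ‖w (src j) - v (src j)‖ ≤ ‖w - v‖ := (w - v).norm_coe_le_norm (src j)
        have e : (N w - N v - L (w - v)) j = n j (w (src j)) - n j (v (src j))
            - fderiv ℂ (n j) (v (src j)) (w (src j) - v (src j)) := by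
          rw [BoundedContinuousFunction.sub_apply, BoundedContinuousFunction.sub_apply,
            hNv w (by linarith), hNv v (by linarith)]
          rfl
        rw [e]
        refine (norm_sub_sub_fderiv_le ((hn j).mono (hsub j)) (fun y hy => hB j y (hsub j hy))
          (by rw [mem_ball, dist_eq_norm]; linarith)).trans ?_
        rw [Real.norm_of_nonneg (by positivity), div_pow]
        have : ‖w (src j) - v (src j)‖ ^ 2 ≤ ‖w - v‖ ^ 2 := by gcongr
        calc 4 * B * (‖w (src j) - v (src j)‖ ^ 2 / (ρ / 2) ^ 2)
            ≤ 4 * B * (‖w - v‖ ^ 2 / (ρ / 2) ^ 2) := by gcongr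
          _ = _ := by ring
      refine hO.trans_isLittleO ?_
      have h0 : Tendsto (fun w => w - v) (𝓝 v) (𝓝 0) :=
        tendsto_sub_nhds_zero_iff.2 tendsto_id
      have := (Asymptotics.isLittleO_norm_pow_id (E' := Y →ᵇ E) one_lt_two).comp_tendsto h0
      simpa [Function.comp_def] using this
    exact hL.differentiableAt

/-- Hahn-Banach: a functional dominated by a linear map factors through that map. -/
theorem exists_strongDual_comp_eq {A B : Type*} [AddCommGroup A] [Module ℂ A]
    [NormedAddCommGroup B] [NormedSpace ℂ B] (D : A →ₗ[ℂ] B) (f : A →ₗ[ℂ] ℂ) {C : ℝ} (hC : 0 ≤ C)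
    (h : ∀ a, ‖f a‖ ≤ C * ‖D a‖) : ∃ g : StrongDual ℂ B, ‖g‖ ≤ C ∧ ∀ a, g (D a) = f a := by
  obtain ⟨s, hs⟩ := D.rangeRestrict.exists_rightInverse_of_surjective D.range_rangeRestrict
  have hs' : ∀ w : LinearMap.range D, D (s w) = w := fun w =>
    congrArg Subtype.val (LinearMap.congr_fun hs w)
  let φ : StrongDual ℂ (LinearMap.range D) := LinearMap.mkContinuous (f ∘ₗ s) C (fun w => by
    have := h (s w)
    rw [hs'] at this
    exact this)
  obtain ⟨g, hg, hgn⟩ := exists_extension_norm_eq (LinearMap.range D) φ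
  refine ⟨g, hgn.trans_le (LinearMap.mkContinuous_norm_le _ hC _), fun a => ?_⟩
  have hmem : D a ∈ LinearMap.range D := ⟨a, rfl⟩
  have h1 : f (s ⟨D a, hmem⟩ - a) = 0 := norm_le_zero_iff.1 (by
    have := h (s ⟨D a, hmem⟩ - a)
    rwa [map_sub D, hs', sub_self, norm_zero, mul_zero] at this)
  rw [map_sub, sub_eq_zero] at h1
  rw [← h1]
  exact hg ⟨D a, hmem⟩

/-- An a priori estimate yields a bounded solution operator for the jump problem. -/
theorem exists_solution_operator [DiscreteTopology Y] {d : ℕ} (src tgt : J → Y) (y₀ : Y)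
    (H : Submodule ℂ (Y →ᵇ (Fin d → ℂ))) {C : ℝ} (hC : 0 ≤ C)
    (hap : ∀ v ∈ H, ∀ ε, (∀ j, ‖v (tgt j) - v (src j)‖ ≤ ε) → ∀ y, ‖v y - v y₀‖ ≤ C * ε)
    (δ : (Y →ᵇ (Fin d → ℂ)) →L[ℂ] (J →ᵇ (Fin d → ℂ)))
    (hδ : ∀ v j, δ v j = v (tgt j) - v (src j)) :
    ∃ R : (J →ᵇ (Fin d → ℂ)) →L[ℂ] (Y →ᵇ (Fin d → ℂ)), ∀ v ∈ H, ∀ y, R (δ v) y = v y - v y₀ := by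
  have hap' : ∀ v ∈ H, ∀ y, ‖v y - v y₀‖ ≤ C * ‖δ v‖ := fun v hv y =>
    hap v hv _ (fun j => by rw [← hδ]; exact (δ v).norm_coe_le_norm j) y
  let f : Y → Fin d → H →ₗ[ℂ] ℂ := fun y k =>
    { toFun := fun v => ((v : Y →ᵇ (Fin d → ℂ)) y - (v : Y →ᵇ (Fin d → ℂ)) y₀) k
      map_add' := fun w w' => by simp; ring
      map_smul' := fun t w => by simp; ring }
  let D : H →ₗ[ℂ] (J →ᵇ (Fin d → ℂ)) := δ.toLinearMap ∘ₗ H.subtype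
  choose g hgn hg using fun y k => exists_strongDual_comp_eq (A := H) D (f y k) hC
    (fun v => (norm_le_pi_norm _ k).trans (hap' v.1 v.2 y))
  have hgb : ∀ (w : J →ᵇ (Fin d → ℂ)) y, ‖fun k => g y k w‖ ≤ C * ‖w‖ := fun w y => by
    rw [pi_norm_le_iff_of_nonneg (by positivity)]
    intro k
    refine ((g y k).le_opNorm w).trans ?_
    gcongr
    exact hgn y k
  let R : (J →ᵇ (Fin d → ℂ)) →L[ℂ] (Y →ᵇ (Fin d → ℂ)) := LinearMap.mkContinuous
    { toFun := fun w => ofNormedAddCommGroupDiscrete (fun y k => g y k w) _ (hgb w)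
      map_add' := fun w w' => by ext y k; simp
      map_smul' := fun t w => by ext y k; simp } C (fun w => by
        rw [BoundedContinuousFunction.norm_le (by positivity)]
        exact hgb w)
  refine ⟨R, fun v hv y => ?_⟩
  ext k
  exact hg y k ⟨v, hv⟩

end ImplicitEquation

section ImplicitEquation

open Metric BoundedContinuousFunction

/-- Suppose that a quadratic jump problem `v (tgt j) = v (src j) + n j (v (src j))`, whose
linearisation satisfies an a priori estimate, is solvable with initial value `c x` for all `x` in
a real submanifold accumulating at the origin whose tangent spaces generate `ℂ^d`. Then it is
solvable for all small initial values. -/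
theorem exists_jump_solution {Y J V : Type*} [NormedAddCommGroup V] [NormedSpace ℝ V]
    {d : ℕ} (src tgt : J → Y) (y₀ : Y) {n : J → (Fin d → ℂ) → (Fin d → ℂ)} {ρ B : ℝ}
    (hρ : 0 < ρ) (hB0 : 0 ≤ B) (hn : ∀ j, DifferentiableOn ℂ (n j) (ball 0 ρ))
    (hB : ∀ j, ∀ x ∈ ball 0 ρ, ‖n j x‖ ≤ B) (hn0 : ∀ j, n j 0 = 0)
    (hn1 : ∀ j, fderiv ℂ (n j) 0 = 0)
    (H : Submodule ℂ (Y → (Fin d → ℂ)))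
    (hclosed : ∀ f : Y → (Fin d → ℂ), (∀ ε > 0, ∃ h ∈ H, ∀ y, ‖f y - h y‖ ≤ ε) → f ∈ H)
    {C : ℝ} (hC : 0 ≤ C)
    (hap : ∀ v ∈ H, ∀ M ε, (∀ y, ‖v y‖ ≤ M) → (∀ j, ‖v (tgt j) - v (src j)‖ ≤ ε) →
      ∀ y, ‖v y - v y₀‖ ≤ C * ε)
    {W : Set V} (hW : IsOpen W) {x₀ : V} (hx₀ : x₀ ∈ closure W) {c : V → (Fin d → ℂ)}
    (hc : ∀ x ∈ W, DifferentiableAt ℝ c x)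
    (hspan : ∀ x ∈ W, Submodule.span ℂ (range (fderiv ℝ c x)) = ⊤)
    (hc0 : Tendsto c (𝓝[W] x₀) (𝓝 0))
    (hsol : ∀ η > 0, ∀ᶠ x in 𝓝[W] x₀, ∃ v ∈ H, v y₀ = c x ∧ (∀ y, ‖v y‖ ≤ η) ∧
      ∀ j, v (tgt j) = v (src j) + n j (v (src j))) {η : ℝ} (hη : 0 < η) :
    ∀ᶠ a in 𝓝 (0 : Fin d → ℂ), ∃ v ∈ H, v y₀ = a ∧ (∀ y, ‖v y‖ ≤ η) ∧
      ∀ j, v (tgt j) = v (src j) + n j (v (src j)) := by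
  let _ : TopologicalSpace Y := ⊥
  have : DiscreteTopology Y := ⟨rfl⟩
  let _ : TopologicalSpace J := ⊥
  have : DiscreteTopology J := ⟨rfl⟩
  have hδb : ∀ (v : Y →ᵇ (Fin d → ℂ)) j, ‖v (tgt j) - v (src j)‖ ≤ 2 * ‖v‖ := fun v j => by
    have := norm_sub_le (v (tgt j)) (v (src j))
    linarith [v.norm_coe_le_norm (tgt j), v.norm_coe_le_norm (src j)]
  let δ : (Y →ᵇ (Fin d → ℂ)) →L[ℂ] (J →ᵇ (Fin d → ℂ)) := LinearMap.mkContinuous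
    { toFun := fun v => ofNormedAddCommGroupDiscrete (fun j => v (tgt j) - v (src j)) _ (hδb v)
      map_add' := fun v w => by
        ext j k
        simp
        ring
      map_smul' := fun t v => by
        ext j k
        simp
        ring } 2 (fun v => by
          rw [BoundedContinuousFunction.norm_le (by positivity)]
          exact hδb v)
  have hδ : ∀ v j, δ v j = v (tgt j) - v (src j) := fun v j => rfl
  let HA : Submodule ℂ (Y →ᵇ (Fin d → ℂ)) :=
    { carrier := {v | (v : Y → (Fin d → ℂ)) ∈ H}
      zero_mem' := H.zero_mem
      add_mem' := fun ha hb => H.add_mem ha hb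
      smul_mem' := fun t _ ha => H.smul_mem t ha }
  have hHA : IsClosed (HA : Set (Y →ᵇ (Fin d → ℂ))) := by
    refine isClosed_of_closure_subset fun f hf => hclosed f fun ε hε => ?_
    obtain ⟨h, hh, hd⟩ := Metric.mem_closure_iff.1 hf ε hε
    refine ⟨h, hh, fun y => ?_⟩
    rw [← dist_eq_norm]
    exact (BoundedContinuousFunction.dist_coe_le_dist y).trans hd.le
  obtain ⟨R, hR⟩ := exists_solution_operator src tgt y₀ HA hC
    (fun v hv ε hj => hap v hv ‖v‖ ε v.norm_coe_le_norm hj) δ hδ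
  obtain ⟨N, hN, hNs, hNd⟩ := exists_superposition (Y := Y) src hρ hB0 hn hB hn0 hn1
  have hN0 : N 0 = 0 := by
    ext j
    rw [hN 0 (by simpa using hρ)]
    simp [hn0]
  have hT : HasStrictFDerivAt (fun v => R (N v))
      (0 : (Y →ᵇ (Fin d → ℂ)) →L[ℂ] (Y →ᵇ (Fin d → ℂ))) 0 := by
    have := R.hasStrictFDerivAt.comp (0 : Y →ᵇ (Fin d → ℂ)) hNs
    rw [ContinuousLinearMap.comp_zero] at this
    exact this
  obtain ⟨G, hG0, hGd, hGr, hGl⟩ := exists_holomorphic_localInverse_sub hT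
    (hNd.mono fun v hv => R.differentiableAt.comp v hv) (by simp [hN0])
  let K : (Fin d → ℂ) →L[ℂ] (Y →ᵇ (Fin d → ℂ)) := LinearMap.mkContinuous
    { toFun := fun a => BoundedContinuousFunction.const Y a
      map_add' := fun v w => rfl
      map_smul' := fun t v => rfl } 1 (fun a => by
        rw [one_mul]
        exact BoundedContinuousFunction.norm_const_le a)
  have hK0 : Tendsto K (𝓝 0) (𝓝 0) := by simpa using K.continuous.tendsto 0
  -- a ball of initial values on which everything is defined
  have hgood : ∀ᶠ v in 𝓝 (0 : Y →ᵇ (Fin d → ℂ)), ‖v‖ < min ρ η ∧ DifferentiableAt ℂ N v := by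
    have h1 : ∀ᶠ v in 𝓝 (0 : Y →ᵇ (Fin d → ℂ)), ‖v‖ < min ρ η := by
      filter_upwards [ball_mem_nhds (0 : Y →ᵇ (Fin d → ℂ)) (lt_min hρ hη)] with v hv
      simpa using hv
    exact h1.and hNd
  obtain ⟨r, hr, hball⟩ := Metric.eventually_nhds_iff_ball.1
    (hK0.eventually ((hG0.eventually hgood).and (hGd.and hGr)))
  have hGK : ∀ a ∈ ball (0 : Fin d → ℂ) r, DifferentiableAt ℂ (fun a => G (K a)) a := fun a ha =>
    (hball a ha).2.1.comp a K.differentiableAt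
  -- on the submanifold the solutions are given by `G`
  obtain ⟨s, hs, hsG⟩ := Metric.eventually_nhds_iff_ball.1 hGl
  have hev := hsol (min (s / 2) (ρ / 2)) (by positivity)
  rw [eventually_nhdsWithin_iff, _root_.eventually_nhds_iff] at hev
  obtain ⟨O, hO, hOo, hxO⟩ := hev
  have hsolG : ∀ x ∈ O ∩ W, G (K (c x)) ∈ HA ∧ G (K (c x)) y₀ = c x ∧
      δ (G (K (c x))) = N (G (K (c x))) := by
    rintro x ⟨hxO, hxW⟩
    obtain ⟨v, hvH, hv0, hvb, hvj⟩ := hO x hxO hxW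
    let v' : Y →ᵇ (Fin d → ℂ) := ofNormedAddCommGroupDiscrete v _ hvb
    have hv'n : ‖v'‖ ≤ min (s / 2) (ρ / 2) :=
      (BoundedContinuousFunction.norm_le (by positivity)).2 hvb
    have hv'ρ : ‖v'‖ < ρ := (hv'n.trans (min_le_right _ _)).trans_lt (by linarith)
    have hv's : ‖v'‖ < s := (hv'n.trans (min_le_left _ _)).trans_lt (by linarith)
    have hNδ : δ v' = N v' := by
      ext1 j
      rw [hδ, hN v' hv'ρ]
      exact sub_eq_iff_eq_add'.2 (hvj j)
    have hΘ : v' - R (N v') = K (c x) := by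
      ext1 y
      rw [BoundedContinuousFunction.sub_apply, ← hNδ, hR v' hvH, sub_sub_cancel]
      exact hv0
    have hGv : G (K (c x)) = v' := by
      rw [← hΘ]
      exact hsG v' (by simpa using hv's)
    rw [hGv]
    exact ⟨hvH, hv0, hNδ⟩
  have hOW : IsOpen (O ∩ W) := hOo.inter hW
  have hne : ∃ x ∈ O ∩ W, c x ∈ ball 0 r := by
    have : (𝓝[W] x₀).NeBot := mem_closure_iff_nhdsWithin_neBot.1 hx₀
    have h1 : ∀ᶠ x in 𝓝[W] x₀, x ∈ O := mem_nhdsWithin_of_mem_nhds (hOo.mem_nhds hxO)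
    have h2 : ∀ᶠ x in 𝓝[W] x₀, x ∈ W := self_mem_nhdsWithin
    obtain ⟨x, h1, h2, h3⟩ := (h1.and (h2.and (hc0.eventually (ball_mem_nhds 0 hr)))).exists
    exact ⟨x, ⟨h1, h2⟩, h3⟩
  have : IsClosed (HA : Set (Y →ᵇ (Fin d → ℂ))) := hHA
  have hmem : ∀ a ∈ ball (0 : Fin d → ℂ) r, G (K a) ∈ HA := by
    intro a ha
    have := eq_zero_of_comp_eq_zero_of_span_eq_top (z := 0) (r := r) hOW
      (fun x hx => hc x hx.2) (fun x hx => hspan x hx.2) (h := fun a => HA.mkQL (G (K a)))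
      (fun a ha => (HA.mkQL.differentiableAt.comp a (hGK a ha)).differentiableWithinAt)
      (fun x hx _ => by
        erw [Submodule.Quotient.mk_eq_zero]
        exact (hsolG x hx).1) hne ha
    exact (Submodule.Quotient.mk_eq_zero _).1 this
  have hval : ∀ a ∈ ball (0 : Fin d → ℂ) r, G (K a) y₀ = a := by
    intro a ha
    have := eq_zero_of_comp_eq_zero_of_span_eq_top (z := 0) (r := r) hOW
      (fun x hx => hc x hx.2) (fun x hx => hspan x hx.2) (h := fun a => BoundedContinuousFunction.evalCLM ℂ y₀ (G (K a)) - a)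
      (fun a ha => ((ContinuousLinearMap.differentiableAt _).comp a (hGK a ha)
        |>.sub differentiableAt_id).differentiableWithinAt)
      (fun x hx _ => sub_eq_zero.2 (hsolG x hx).2.1) hne ha
    exact sub_eq_zero.1 this
  have hjump : ∀ a ∈ ball (0 : Fin d → ℂ) r, δ (G (K a)) = N (G (K a)) := by
    intro a ha
    have := eq_zero_of_comp_eq_zero_of_span_eq_top (z := 0) (r := r) hOW
      (fun x hx => hc x hx.2) (fun x hx => hspan x hx.2) (h := fun a => δ (G (K a)) - N (G (K a)))
      (fun a ha => ((δ.differentiableAt.comp a (hGK a ha)).sub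
        ((hball a ha).1.2.comp a (hGK a ha))).differentiableWithinAt)
      (fun x hx _ => sub_eq_zero.2 (hsolG x hx).2.2) hne ha
    exact sub_eq_zero.1 this
  filter_upwards [ball_mem_nhds (0 : Fin d → ℂ) hr] with a ha
  have hlt := (hball a ha).1.1
  refine ⟨G (K a), hmem a ha, hval a ha, fun y => ((G (K a)).norm_coe_le_norm y).trans
    (hlt.le.trans (min_le_right _ _)), fun j => ?_⟩
  have h1 := congrArg (fun f : J →ᵇ (Fin d → ℂ) => f j) (hjump a ha)
  simp only [hδ, hN _ (hlt.trans_le (min_le_left _ _))] at h1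
  exact sub_eq_iff_eq_add'.1 h1

end ImplicitEquation

section Rigidity

open Metric

/-- A holomorphic map bounded by `M` which vanishes to second order at the origin is Lipschitz on
small balls, with a small constant. -/
theorem norm_sub_le_of_fderiv_eq_zero {E F : Type*} [NormedAddCommGroup E] [NormedSpace ℂ E]
    [NormedAddCommGroup F] [NormedSpace ℂ F] {f : E → F} {R M s : ℝ}
    (hd : DifferentiableOn ℂ f (ball 0 R)) (hM : ∀ y ∈ ball 0 R, ‖f y‖ ≤ M) (h0 : f 0 = 0)
    (h1 : fderiv ℂ f 0 = 0) (hs : 0 < s) (hsR : 2 * s ≤ R) {x y : E} (hx : x ∈ ball 0 s)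
    (hy : y ∈ ball 0 s) : ‖f x - f y‖ ≤ 32 * M * s / R ^ 2 * ‖x - y‖ := by
  have hR : 0 < R := by linarith
  have hM0 : 0 ≤ M := (norm_nonneg _).trans (hM 0 (mem_ball_self hR))
  have hsub : ∀ z ∈ ball (0 : E) s, ball z s ⊆ ball 0 (2 * s) := fun z hz =>
    ball_subset_ball' (by have := mem_ball.1 hz; linarith)
  have hq : ∀ z ∈ ball (0 : E) (2 * s), ‖f z‖ ≤ 16 * M * (s / R) ^ 2 := by
    intro z hz
    have := norm_sub_sub_fderiv_le hd hM (ball_subset_ball hsR hz)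
    rw [h0, h1] at this
    simp only [sub_zero, _root_.zero_apply] at this
    refine this.trans ?_
    have hz' : ‖z‖ ≤ 2 * s := (mem_ball_zero_iff.1 hz).le
    have : ‖z‖ / R ≤ 2 * (s / R) := by
      rw [← mul_div_assoc]
      gcongr
    calc 4 * M * (‖z‖ / R) ^ 2 ≤ 4 * M * (2 * (s / R)) ^ 2 := by gcongr
      _ = _ := by ring
  have hdz : ∀ z ∈ ball (0 : E) s, DifferentiableAt ℂ f z := fun z hz =>
    (hd.differentiableAt (isOpen_ball.mem_nhds (ball_subset_ball (by linarith) hz)))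
  refine (convex_ball (0 : E) s).norm_image_sub_le_of_norm_fderiv_le (𝕜 := ℂ) hdz (fun z hz => ?_)
    hy hx
  have := norm_fderiv_le_of_norm_le_ball hs
    (hd.mono ((hsub z hz).trans (ball_subset_ball hsR))) fun y hy => hq y (hsub z hz hy)
  refine this.trans_eq ?_
  field_simp
  ring

/-- The complexification map `(y, u) ↦ (y₀, y₁, u)`. -/
noncomputable def toComplexThree : Model 2 →L[ℝ] (Fin 3 → ℂ) :=
  ContinuousLinearMap.pi ![(ContinuousLinearMap.proj 0).comp (ContinuousLinearMap.fst ℝ _ _),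
    (ContinuousLinearMap.proj 1).comp (ContinuousLinearMap.fst ℝ _ _),
    Complex.ofRealCLM.comp (ContinuousLinearMap.snd ℝ _ _)]

theorem toComplexThree_apply (w : Model 2) : toComplexThree w = ![w.1 0, w.1 1, (w.2 : ℂ)] := by
  ext k
  fin_cases k <;> rfl

theorem norm_toComplexThree_le (w : Model 2) : ‖toComplexThree w‖ ≤ ‖w‖ := by
  rw [toComplexThree_apply, pi_norm_le_iff_of_nonneg (norm_nonneg _)]
  intro k
  fin_cases k
  · exact (norm_le_pi_norm w.1 0).trans (norm_fst_le w)
  · exact (norm_le_pi_norm w.1 1).trans (norm_fst_le w)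
  · simpa using norm_snd_le w

theorem eq_zero_of_comp_toComplexThree_eq_zero {F : Type*} [NormedAddCommGroup F]
    [NormedSpace ℂ F] {N : (Fin 3 → ℂ) →L[ℂ] F} (h : ∀ w, N (toComplexThree w) = 0) : N = 0 := by
  ext c
  have hc : c = c 0 • toComplexThree (![1, 0], 0) + c 1 • toComplexThree (![0, 1], 0) +
      c 2 • toComplexThree (0, 1) := by
    ext k
    fin_cases k <;> simp [toComplexThree_apply]
  rw [hc]
  simp [h]

/-- The points of `ℂ² × ℝ` on the complex line `ℂ × 0 × 0`. -/
def axisPoint (ζ : ℂ) : Model 2 := (![ζ, 0], 0)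

theorem axisPoint_add (ζ ξ : ℂ) : axisPoint (ζ + ξ) = axisPoint ζ + axisPoint ξ := by
  simp [axisPoint]

theorem axisPoint_zero : axisPoint 0 = 0 := by
  ext k
  · fin_cases k <;> rfl
  · rfl

theorem norm_axisPoint (ζ : ℂ) : ‖axisPoint ζ‖ = ‖ζ‖ := by
  refine le_antisymm ?_ ((norm_le_pi_norm (axisPoint ζ).1 0).trans (norm_fst_le _))
  refine max_le ((pi_norm_le_iff_of_nonneg (norm_nonneg _)).2 fun k => ?_) (by simp [axisPoint])
  fin_cases k <;> simp [axisPoint]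

theorem toComplexThree_axisPoint (ζ : ℂ) :
    toComplexThree (axisPoint ζ) = ζ • ![(1 : ℂ), 0, 0] := by
  ext k
  fin_cases k <;> simp [toComplexThree_apply, axisPoint]

/-- The maps `e (·, u)` are periodic with respect to the lattice generated by `1` and `t u * I` in
the first variable. -/
def LatticePeriodic {X : Type*} (e : Model 2 → X) (t : ℝ → ℝ) : Prop :=
  ∀ (x : Model 2) (m k : ℤ), e (x + axisPoint (m + k * (t x.2 * I))) = e x

theorem LatticePeriodic.apply_eq {X : Type*} {e : Model 2 → X} {t : ℝ → ℝ}
    (he : LatticePeriodic e t) {ζ ζ' : ℂ} (h : ζ - ζ' ∈ squareLattice) (w : Model 2) :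
    e (axisPoint ζ + (w + axisPoint (((ζ - ζ').im * (t w.2 - 1) : ℝ) * I))) =
      e (axisPoint ζ' + w) := by
  obtain ⟨m, k, hmk⟩ := h
  have hx : (axisPoint ζ' + w).2 = w.2 := by simp [axisPoint]
  have him : (ζ - ζ').im = k := by simp [hmk]
  rw [← he (axisPoint ζ' + w) m k, hx, add_right_comm (axisPoint ζ'), ← axisPoint_add,
    add_comm w, ← add_assoc, ← axisPoint_add, him, eq_add_of_sub_eq hmk]
  congr 3
  push_cast
  ring

theorem LatticePeriodic.apply_eq_of_eq_one {X : Type*} {e : Model 2 → X} {t : ℝ → ℝ}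
    (he : LatticePeriodic e t) {ζ ζ' : ℂ} (h : ζ - ζ' ∈ squareLattice) {w : Model 2}
    (hw : t w.2 = 1) : e (axisPoint ζ + w) = e (axisPoint ζ' + w) := by
  have := he.apply_eq h w
  rw [hw] at this
  simpa [axisPoint_zero] using this

end Rigidity

section Rigidity

open Metric

/-- Families of maps which are holomorphic on the discs `ball (p i) (2 * ρ i)`, extended by a
constant outside. -/
def holomorphicFamilies {ι : Type*} (p : ι → ℂ) (ρ : ι → ℝ) (d : ℕ) :
    Submodule ℂ (ι × ℂ → (Fin d → ℂ)) where
  carrier := {v | ∀ i, DifferentiableOn ℂ (fun ζ => v (i, ζ)) (ball (p i) (2 * ρ i)) ∧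
    ∀ ζ ∉ ball (p i) (2 * ρ i), v (i, ζ) = v (i, p i)}
  zero_mem' := fun i => ⟨differentiableOn_const _, fun ζ _ => rfl⟩
  add_mem' := fun ha hb i => ⟨(ha i).1.add (hb i).1, fun ζ hζ => by
    simp [(ha i).2 ζ hζ, (hb i).2 ζ hζ]⟩
  smul_mem' := fun c _ ha i => ⟨(ha i).1.const_smul c, fun ζ hζ => by
    simp [(ha i).2 ζ hζ]⟩

theorem mem_holomorphicFamilies {ι : Type*} {p : ι → ℂ} {ρ : ι → ℝ} {d : ℕ}
    {v : ι × ℂ → (Fin d → ℂ)} : v ∈ holomorphicFamilies p ρ d ↔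
      ∀ i, DifferentiableOn ℂ (fun ζ => v (i, ζ)) (ball (p i) (2 * ρ i)) ∧
        ∀ ζ ∉ ball (p i) (2 * ρ i), v (i, ζ) = v (i, p i) := Iff.rfl

theorem mem_holomorphicFamilies_of_forall_approx {ι : Type*} {p : ι → ℂ} {ρ : ι → ℝ} {d : ℕ}
    {f : ι × ℂ → (Fin d → ℂ)}
    (hf : ∀ ε > 0, ∃ h ∈ holomorphicFamilies p ρ d, ∀ y, ‖f y - h y‖ ≤ ε) :
    f ∈ holomorphicFamilies p ρ d := by
  have hpos : ∀ k : ℕ, (0 : ℝ) < 1 / (k + 1) := fun k => by positivity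
  choose h hh hfh using fun k : ℕ => hf _ (hpos k)
  have hu : ∀ i, TendstoUniformly (fun k ζ => h k (i, ζ)) (fun ζ => f (i, ζ)) atTop := by
    intro i
    rw [Metric.tendstoUniformly_iff]
    intro ε hε
    filter_upwards [tendsto_one_div_add_atTop_nhds_zero_nat.eventually (gt_mem_nhds hε)]
      with k hk ζ
    rw [dist_eq_norm]
    exact (hfh k _).trans_lt hk
  refine mem_holomorphicFamilies.2 fun i => ⟨?_, fun ζ hζ => ?_⟩
  · exact (hu i).tendstoUniformlyOn.tendstoLocallyUniformlyOn.differentiableOn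
      (Eventually.of_forall fun k => (hh k i).1) isOpen_ball
  · refine tendsto_nhds_unique ((hu i).tendsto_at ζ) ?_
    simp only [(hh _ i).2 ζ hζ]
    exact (hu i).tendsto_at (p i)

theorem holomorphicFamilies_restrict_mem {ι : Type*} {p : ι → ℂ} {ρ : ι → ℝ} {d : ℕ}
    (hρ : ∀ i, 0 < ρ i) {v : ι → ℂ → (Fin d → ℂ)}
    (hv : ∀ i, DifferentiableOn ℂ (v i) (ball (p i) (2 * ρ i))) [∀ i (ζ : ℂ),
      Decidable (ζ ∈ ball (p i) (2 * ρ i))] :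
    (fun y : ι × ℂ => v y.1 (if y.2 ∈ ball (p y.1) (2 * ρ y.1) then y.2 else p y.1)) ∈
      holomorphicFamilies p ρ d := by
  refine mem_holomorphicFamilies.2 fun i => ⟨(hv i).congr fun ζ hζ => by simp only [if_pos hζ],
    fun ζ hζ => ?_⟩
  have : p i ∈ ball (p i) (2 * ρ i) := mem_ball_self (by linarith [hρ i])
  simp only [if_neg hζ, if_pos this]

/-- A priori estimate for the linearised jump problem. -/
theorem exists_forall_norm_sub_le_of_mem_holomorphicFamilies {ι : Type*} [Finite ι] {p : ι → ℂ}
    {ρ : ι → ℝ} {d : ℕ} (i₀ : ι)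
    (hcov : ∀ ζ : ℂ, ∃ i, ∃ ζ' ∈ ball (p i) (ρ i), ζ - ζ' ∈ squareLattice) (hρ : ∀ i, 0 < ρ i) :
    ∃ C > 0, ∀ v ∈ holomorphicFamilies p ρ d, ∀ M ε, (∀ y, ‖v y‖ ≤ M) →
      (∀ i j, ∀ ζ ∈ ball (p i) (2 * ρ i), ∀ ζ' ∈ ball (p j) (2 * ρ j), ζ - ζ' ∈ squareLattice →
        ‖v (j, ζ') - v (i, ζ)‖ ≤ ε) → ∀ y, ‖v y - v (i₀, p i₀)‖ ≤ C * ε := by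
  obtain ⟨C, hC, H⟩ := exists_le_of_jumpBound (E := Fin d → ℂ) (i₀ := i₀) hcov hρ
  refine ⟨C, hC, fun v hv M ε hM hj => ?_⟩
  obtain ⟨h1, -⟩ := H (fun i ζ => v (i, ζ) - v (i₀, p i₀)) 0 ε (M + M)
    (fun i => (hv i).1.sub_const _) (sub_self _)
    (fun i ζ _ => (norm_sub_le _ _).trans (add_le_add (hM _) (hM _)))
    (fun i j ζ hζ ζ' hζ' hL => by simpa using hj i j ζ hζ ζ' hζ' hL)
  rintro ⟨i, ζ⟩
  by_cases hζ : ζ ∈ ball (p i) (2 * ρ i)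
  · exact h1 i ζ hζ
  · rw [(hv i).2 ζ hζ]
    exact h1 i (p i) (mem_ball_self (by linarith [hρ i]))

end Rigidity

section Rigidity

open Metric

/-- Linearising coordinates along the elliptic curve: near the curve `ζ ↦ e (axisPoint ζ)` the
translate by `w` is described over the disc `ball (p i) (2 * ρ i)` by the map `Q i · w`, which
to first order is `w` itself, and the map `id + n i j ζ ζ'` is the change of coordinates over
congruent points `ζ` and `ζ'`. -/
structure IsLinearising {X ι : Type*} (e : Model 2 → X) (p : ι → ℂ) (ρ : ι → ℝ) (i₀ : ι)
    (Q : ι → ℂ → Model 2 → (Fin 3 → ℂ)) (n : ι → ι → ℂ → ℂ → (Fin 3 → ℂ) → (Fin 3 → ℂ))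
    (r R : ℝ) : Prop where
  r_pos : 0 < r
  R_pos : 0 < R
  zero_right : ∀ i ζ, Q i ζ 0 = 0
  differentiableOn : ∀ i, ∀ w ∈ ball (0 : Model 2) r,
    DifferentiableOn ℂ (fun ζ => Q i ζ w) (ball (p i) (2 * ρ i))
  strict : ∀ η > 0, ∃ s > 0, ∀ i, ∀ ζ ∈ ball (p i) (2 * ρ i), ∀ w ∈ ball (0 : Model 2) s,
    ∀ w' ∈ ball (0 : Model 2) s,
      ‖Q i ζ w - Q i ζ w' - toComplexThree (w - w')‖ ≤ η * ‖w - w'‖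
  jump : ∀ i j, ∀ ζ ∈ ball (p i) (2 * ρ i), ∀ ζ' ∈ ball (p j) (2 * ρ j),
    ∀ w ∈ ball (0 : Model 2) r, ∀ w' ∈ ball (0 : Model 2) r,
      e (axisPoint ζ + w) = e (axisPoint ζ' + w') → Q j ζ' w' = Q i ζ w + n i j ζ ζ' (Q i ζ w)
  holomorphic : ∀ i j, ∀ ζ ∈ ball (p i) (2 * ρ i), ∀ ζ' ∈ ball (p j) (2 * ρ j),
    ζ - ζ' ∈ squareLattice → DifferentiableOn ℂ (n i j ζ ζ') (ball 0 R)
  norm_le_one : ∀ i j, ∀ ζ ∈ ball (p i) (2 * ρ i), ∀ ζ' ∈ ball (p j) (2 * ρ j),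
    ζ - ζ' ∈ squareLattice → ∀ v ∈ ball 0 R, ‖n i j ζ ζ' v‖ ≤ 1
  differentiableAt : ∀ w ∈ ball (0 : Model 2) r, DifferentiableAt ℝ (Q i₀ (p i₀)) w
  span_eq_top : ∀ w ∈ ball (0 : Model 2) r,
    Submodule.span ℂ (range (fderiv ℝ (Q i₀ (p i₀)) w)) = ⊤

namespace IsLinearising

variable {X ι : Type*} {e : Model 2 → X} {t : ℝ → ℝ} {p : ι → ℂ} {ρ : ι → ℝ} {i₀ : ι}
  {Q : ι → ℂ → Model 2 → (Fin 3 → ℂ)} {n : ι → ι → ℂ → ℂ → (Fin 3 → ℂ) → (Fin 3 → ℂ)} {r R : ℝ}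

theorem exists_norm_le (h : IsLinearising e p ρ i₀ Q n r R) :
    ∃ s > 0, ∀ i, ∀ ζ ∈ ball (p i) (2 * ρ i), ∀ w ∈ ball (0 : Model 2) s,
      ‖Q i ζ w‖ ≤ 2 * ‖w‖ := by
  obtain ⟨s, hs, H⟩ := h.strict 1 one_pos
  refine ⟨s, hs, fun i ζ hζ w hw => ?_⟩
  have := H i ζ hζ w hw 0 (mem_ball_self hs)
  rw [h.zero_right, sub_zero, sub_zero, one_mul] at this
  linarith [norm_sub_norm_le (Q i ζ w) (toComplexThree w), norm_toComplexThree_le w]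

theorem hasFDerivAt_zero (h : IsLinearising e p ρ i₀ Q n r R) {i : ι} {ζ : ℂ}
    (hζ : ζ ∈ ball (p i) (2 * ρ i)) : HasFDerivAt (Q i ζ) toComplexThree 0 := by
  rw [hasFDerivAt_iff_isLittleO, Asymptotics.isLittleO_iff]
  intro η hη
  obtain ⟨s, hs, H⟩ := h.strict η hη
  filter_upwards [ball_mem_nhds 0 hs] with w hw
  exact H i ζ hζ w hw 0 (mem_ball_self hs)

theorem apply_zero (h : IsLinearising e p ρ i₀ Q n r R) (he : LatticePeriodic e t)
    (ht : ∀ u ≤ 0, t u = 1) {i j : ι} {ζ ζ' : ℂ} (hζ : ζ ∈ ball (p i) (2 * ρ i))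
    (hζ' : ζ' ∈ ball (p j) (2 * ρ j)) (hL : ζ - ζ' ∈ squareLattice) : n i j ζ ζ' 0 = 0 := by
  have := h.jump i j ζ hζ ζ' hζ' 0 (mem_ball_self h.r_pos) 0 (mem_ball_self h.r_pos)
    (he.apply_eq_of_eq_one hL (ht _ le_rfl))
  simpa [h.zero_right] using this.symm

theorem fderiv_zero (h : IsLinearising e p ρ i₀ Q n r R) (he : LatticePeriodic e t)
    (ht : ∀ u ≤ 0, t u = 1) {i j : ι} {ζ ζ' : ℂ} (hζ : ζ ∈ ball (p i) (2 * ρ i))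
    (hζ' : ζ' ∈ ball (p j) (2 * ρ j)) (hL : ζ - ζ' ∈ squareLattice) :
    fderiv ℂ (n i j ζ ζ') 0 = 0 := by
  set S : Set (Model 2) := univ ×ˢ Iic 0 with hS
  have hn : HasFDerivAt (n i j ζ ζ') (fderiv ℂ (n i j ζ ζ') 0) (Q i ζ 0) := by
    rw [h.zero_right]
    exact ((h.holomorphic i j ζ hζ ζ' hζ' hL).differentiableAt
      (ball_mem_nhds 0 h.R_pos)).hasFDerivAt
  have h1 : HasFDerivWithinAt (fun w => n i j ζ ζ' (Q i ζ w))
      (((fderiv ℂ (n i j ζ ζ') 0).restrictScalars ℝ).comp toComplexThree) S 0 :=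
    ((hn.restrictScalars ℝ).comp 0 (h.hasFDerivAt_zero hζ)).hasFDerivWithinAt
  have h2 : HasFDerivWithinAt (fun w => n i j ζ ζ' (Q i ζ w))
      (toComplexThree - toComplexThree) S 0 := by
    refine (((h.hasFDerivAt_zero hζ').sub (h.hasFDerivAt_zero hζ)).hasFDerivWithinAt
      ).congr_of_eventuallyEq ?_ ?_
    · filter_upwards [self_mem_nhdsWithin, mem_nhdsWithin_of_mem_nhds (ball_mem_nhds 0 h.r_pos)]
        with w hw hwr
      rw [Pi.sub_apply, h.jump i j ζ hζ ζ' hζ' w hwr w hwr (he.apply_eq_of_eq_one hL (ht _ hw.2)),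
        add_sub_cancel_left]
    · simp [h.zero_right, h.apply_zero he ht hζ hζ' hL]
  have hu : UniqueDiffWithinAt ℝ S 0 :=
    (uniqueDiffOn_univ.prod (uniqueDiffOn_Iic 0)) 0 ⟨mem_univ _, le_refl (0 : ℝ)⟩
  have h3 := hu.eq h1 h2
  rw [sub_self] at h3
  exact eq_zero_of_comp_toComplexThree_eq_zero fun w => DFunLike.congr_fun h3 w

/-- The jump problem is solvable for all small initial values. -/
theorem exists_solution [Finite ι] (h : IsLinearising e p ρ i₀ Q n r R)
    (he : LatticePeriodic e t) (ht : ∀ u ≤ 0, t u = 1)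
    (hcov : ∀ ζ : ℂ, ∃ i, ∃ ζ' ∈ ball (p i) (ρ i), ζ - ζ' ∈ squareLattice)
    (hρ : ∀ i, 0 < ρ i) {η : ℝ} (hη : 0 < η) :
    ∀ᶠ a in 𝓝 (0 : Fin 3 → ℂ), ∃ v ∈ holomorphicFamilies p ρ 3, v (i₀, p i₀) = a ∧
      (∀ y, ‖v y‖ ≤ η) ∧ ∀ i j, ∀ ζ ∈ ball (p i) (2 * ρ i), ∀ ζ' ∈ ball (p j) (2 * ρ j),
        ζ - ζ' ∈ squareLattice → v (j, ζ') = v (i, ζ) + n i j ζ ζ' (v (i, ζ)) := by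
  classical
  let J := {x : (ι × ι) × (ℂ × ℂ) // x.2.1 ∈ ball (p x.1.1) (2 * ρ x.1.1) ∧
    x.2.2 ∈ ball (p x.1.2) (2 * ρ x.1.2) ∧ x.2.1 - x.2.2 ∈ squareLattice}
  obtain ⟨C, hC, hap⟩ := exists_forall_norm_sub_le_of_mem_holomorphicFamilies (d := 3) i₀ hcov hρ
  have hp₀ : p i₀ ∈ ball (p i₀) (2 * ρ i₀) := mem_ball_self (by linarith [hρ i₀])
  obtain ⟨s, hs, hle⟩ := h.exists_norm_le
  have key := exists_jump_solution (J := J) (fun x => (x.1.1.1, x.1.2.1))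
    (fun x => (x.1.1.2, x.1.2.2)) (i₀, p i₀) (n := fun x => n x.1.1.1 x.1.1.2 x.1.2.1 x.1.2.2)
    h.R_pos zero_le_one (fun x => h.holomorphic _ _ _ x.2.1 _ x.2.2.1 x.2.2.2)
    (fun x => h.norm_le_one _ _ _ x.2.1 _ x.2.2.1 x.2.2.2)
    (fun x => h.apply_zero he ht x.2.1 x.2.2.1 x.2.2.2)
    (fun x => h.fderiv_zero he ht x.2.1 x.2.2.1 x.2.2.2) (holomorphicFamilies p ρ 3)
    (fun f hf => mem_holomorphicFamilies_of_forall_approx hf) hC.le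
    (fun v hv M ε hM hj => hap v hv M ε hM fun i j ζ hζ ζ' hζ' hL =>
      hj ⟨((i, j), (ζ, ζ')), hζ, hζ', hL⟩)
    (W := ball (0 : Model 2) r ∩ {w | w.2 < 0})
    (isOpen_ball.inter (isOpen_lt continuous_snd continuous_const)) (x₀ := 0) ?_
    (c := Q i₀ (p i₀)) (fun w hw => h.differentiableAt w hw.1) (fun w hw => h.span_eq_top w hw.1)
    ?_ ?_ hη
  · filter_upwards [key] with a ha
    obtain ⟨v, hv, hva, hvη, hvj⟩ := ha
    exact ⟨v, hv, hva, hvη, fun i j ζ hζ ζ' hζ' hL => hvj ⟨((i, j), (ζ, ζ')), hζ, hζ', hL⟩⟩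
  · rw [Metric.mem_closure_iff]
    intro ε hε
    have hr := h.r_pos
    have hm : 0 < min ε r / 2 := by positivity
    refine ⟨(0, -(min ε r / 2)), ⟨?_, ?_⟩, ?_⟩
    · rw [mem_ball_zero_iff]
      refine max_lt (by simpa using hr) ?_
      rw [norm_neg, Real.norm_of_nonneg hm.le]
      linarith [min_le_right ε r]
    · exact neg_lt_zero.2 hm
    · rw [dist_zero_left]
      refine max_lt (by simpa using hε) ?_
      rw [norm_neg, Real.norm_of_nonneg hm.le]
      linarith [min_le_left ε r]
  · have := (h.hasFDerivAt_zero hp₀).continuousAt.tendsto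
    rw [h.zero_right] at this
    exact this.mono_left nhdsWithin_le_nhds
  · intro η hη
    filter_upwards [self_mem_nhdsWithin, mem_nhdsWithin_of_mem_nhds (ball_mem_nhds 0 hs),
      mem_nhdsWithin_of_mem_nhds (ball_mem_nhds 0 (half_pos hη))] with w hw hws hwη
    rw [mem_ball_zero_iff] at hwη
    refine ⟨_, holomorphicFamilies_restrict_mem hρ (v := fun i ζ => Q i ζ w)
      (fun i => h.differentiableOn i w hw.1), ?_, ?_, ?_⟩
    · simp only [if_pos hp₀]
    · rintro ⟨i, ζ⟩
      have hmem : (if ζ ∈ ball (p i) (2 * ρ i) then ζ else p i) ∈ ball (p i) (2 * ρ i) := by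
        split_ifs with hζ
        · exact hζ
        · exact mem_ball_self (by linarith [hρ i])
      linarith [hle i _ hmem w hws]
    · rintro ⟨⟨⟨i, j⟩, ⟨ζ, ζ'⟩⟩, hζ, hζ', hL⟩
      simp only at hζ hζ' hL
      simp only [if_pos hζ, if_pos hζ']
      exact h.jump i j ζ hζ ζ' hζ' w hw.1 w hw.1
        (he.apply_eq_of_eq_one hL (ht _ (le_of_lt hw.2)))

end IsLinearising

end Rigidity

section Rigidity

open Metric

/-- If linearising coordinates exist, then the modulus of the leafwise elliptic curves is locally
constant. -/
theorem IsLinearising.eventually_eq_one {X ι : Type*} {e : Model 2 → X} {t : ℝ → ℝ} {p : ι → ℂ}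
    {ρ : ι → ℝ} {i₀ : ι} {Q : ι → ℂ → Model 2 → (Fin 3 → ℂ)}
    {n : ι → ι → ℂ → ℂ → (Fin 3 → ℂ) → (Fin 3 → ℂ)} {r R : ℝ} [Finite ι]
    (h : IsLinearising e p ρ i₀ Q n r R) (he : LatticePeriodic e t) (ht : ∀ u ≤ 0, t u = 1)
    (htc : ContinuousAt t 0)
    (hcov : ∀ ζ : ℂ, ∃ i, ∃ ζ' ∈ ball (p i) (ρ i), ζ - ζ' ∈ squareLattice)
    (hρ : ∀ i, 0 < ρ i) : ∀ᶠ u in 𝓝 0, t u = 1 := by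
  have hp : ∀ i, p i ∈ ball (p i) (2 * ρ i) := fun i => mem_ball_self (by linarith [hρ i])
  have hr := h.r_pos
  have hR := h.R_pos
  obtain ⟨C, hC, hap⟩ := exists_le_of_jumpBound (E := Fin 3 → ℂ) (i₀ := i₀) hcov hρ
  obtain ⟨D₀, hD₀⟩ := Finite.exists_le fun i => ‖p i‖ + 2 * ρ i
  have hball : ∀ i, ∀ ζ ∈ ball (p i) (2 * ρ i), ‖ζ‖ ≤ D₀ := by
    intro i ζ hζ
    have h1 := mem_ball_iff_norm.1 hζ
    linarith [hD₀ i, norm_sub_norm_le ζ (p i)]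
  have hD₀pos : 0 < D₀ := by linarith [hD₀ i₀, norm_nonneg (p i₀), hρ i₀]
  obtain ⟨D, hDdef⟩ : ∃ D, D = 2 * D₀ := ⟨_, rfl⟩
  have hD : 0 < D := by linarith
  obtain ⟨κ, hκ, hκ1, hκ2, hκ3⟩ : ∃ κ > 0, κ ≤ 1 ∧ C * κ ≤ 1 / 4 ∧
      C * (κ * D + 2 * D * κ) ≤ 1 / 4 := by
    refine ⟨min 1 (1 / (4 * C * (1 + 3 * D))), by positivity, min_le_left _ _, ?_, ?_⟩
    all_goals
      have h1 := min_le_right 1 (1 / (4 * C * (1 + 3 * D)))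
      have h2 : 0 < min 1 (1 / (4 * C * (1 + 3 * D))) := by positivity
      set κ := min 1 (1 / (4 * C * (1 + 3 * D)))
      rw [le_div_iff₀ (by positivity)] at h1
      nlinarith [mul_pos hC hD, mul_pos (mul_pos hC h2) hD, mul_pos hC h2]
  obtain ⟨s, hs, hsR, hsκ⟩ : ∃ s > 0, 2 * s ≤ R ∧ 32 * 1 * s / R ^ 2 ≤ κ := by
    refine ⟨min (R / 2) (κ * R ^ 2 / 32), by positivity, ?_, ?_⟩
    · linarith [min_le_left (R / 2) (κ * R ^ 2 / 32)]
    · rw [div_le_iff₀ (by positivity)]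
      linarith [min_le_right (R / 2) (κ * R ^ 2 / 32)]
  obtain ⟨s₁, hs₁, hstrict⟩ := h.strict κ hκ
  obtain ⟨s₂, hs₂, hle⟩ := h.exists_norm_le
  have hsmall : ∀ᶠ u in 𝓝 (0 : ℝ), |u| + D * |t u - 1| < min (min r s₁) (min s₂ (s / 2)) := by
    have h0 : ContinuousAt (fun u => |u| + D * |t u - 1|) 0 := by fun_prop
    refine h0.eventually_lt_const ?_
    simp [ht 0 le_rfl, hr, hs₁, hs₂, hs]
  have hinit : Tendsto (fun u : ℝ => Q i₀ (p i₀) (0, u)) (𝓝 0) (𝓝 0) := by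
    have h1 := (h.hasFDerivAt_zero (hp i₀)).continuousAt.tendsto
    rw [h.zero_right] at h1
    exact h1.comp ((Continuous.prodMk_right (0 : Fin 2 → ℂ)).tendsto' 0 0 rfl)
  filter_upwards [hsmall,
    hinit.eventually (h.exists_solution he ht hcov hρ (half_pos hs))] with u hu hsol
  obtain ⟨v, hv, hv₀, hvs, hvj⟩ := hsol
  simp only [lt_min_iff] at hu
  obtain ⟨⟨hur, hu₁⟩, hu₂, hu₃⟩ := hu
  obtain ⟨τ, hτ⟩ : ∃ τ, τ = |t u - 1| := ⟨_, rfl⟩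
  have hτ0 : 0 ≤ τ := hτ ▸ abs_nonneg _
  rw [← hτ] at hur hu₁ hu₂ hu₃
  have hDτ : 0 ≤ D * τ := by positivity
  set w : Model 2 := (0, u) with hw
  have hwn : ‖w‖ = |u| := by simp [hw, Prod.norm_def]
  have hσ : ‖((t u - 1 : ℝ) * I : ℂ) • ![(1 : ℂ), 0, 0]‖ = τ := by
    rw [← toComplexThree_axisPoint, toComplexThree_apply, hτ]
    refine le_antisymm ((pi_norm_le_iff_of_nonneg (abs_nonneg _)).2 fun k => ?_) ?_
    · fin_cases k <;> simp [axisPoint, -ofReal_sub]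
    · refine le_trans ?_ (norm_le_pi_norm _ 0)
      simp [axisPoint, -ofReal_sub]
  set σ : Fin 3 → ℂ := ((t u - 1 : ℝ) * I : ℂ) • ![(1 : ℂ), 0, 0] with hσdef
  have hbdd : ∀ i, ∀ ζ ∈ ball (p i) (2 * ρ i), ‖Q i ζ w - v (i, ζ)‖ ≤ 2 * s := by
    intro i ζ hζ
    have h1 := hle i ζ hζ w (by rw [mem_ball_zero_iff, hwn]; linarith)
    linarith [norm_sub_le (Q i ζ w) (v (i, ζ)), hvs (i, ζ)]
  obtain ⟨M, hM, hMle⟩ : ∃ M, (∀ i, ∀ ζ ∈ ball (p i) (2 * ρ i), ‖Q i ζ w - v (i, ζ)‖ ≤ M) ∧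
      ∀ B, (∀ i, ∀ ζ ∈ ball (p i) (2 * ρ i), ‖Q i ζ w - v (i, ζ)‖ ≤ B) → M ≤ B := by
    set S : Set ℝ := {x | ∃ i, ∃ ζ ∈ ball (p i) (2 * ρ i), ‖Q i ζ w - v (i, ζ)‖ = x} with hS
    have hne : S.Nonempty := ⟨_, i₀, p i₀, hp i₀, rfl⟩
    refine ⟨sSup S, fun i ζ hζ => le_csSup ⟨2 * s, ?_⟩ ⟨i, ζ, hζ, rfl⟩, fun B hB =>
      csSup_le hne ?_⟩
    · rintro _ ⟨i, ζ, hζ, rfl⟩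
      exact hbdd i ζ hζ
    · rintro _ ⟨i, ζ, hζ, rfl⟩
      exact hB i ζ hζ
  have hjb : JumpBound p ρ (fun i ζ => Q i ζ w - v (i, ζ)) σ
      (κ * (D * τ) + κ * (M + 2 * (D * τ))) := by
    intro i j ζ hζ ζ' hζ' hL
    set k := (ζ - ζ').im with hk
    have hkD : |k| ≤ D := by
      have h1 := abs_im_le_norm (ζ - ζ')
      linarith [norm_sub_le ζ ζ', hball i ζ hζ, hball j ζ' hζ']
    set w' := w + axisPoint ((k * (t u - 1) : ℝ) * I) with hw'
    have hww : w' - w = axisPoint ((k * (t u - 1) : ℝ) * I) := add_sub_cancel_left _ _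
    have hdist : ‖w' - w‖ ≤ D * τ := by
      rw [hww, norm_axisPoint, norm_mul, norm_I, mul_one, norm_real, Real.norm_eq_abs, abs_mul,
        ← hτ]
      gcongr
    have hw'n : ‖w'‖ ≤ |u| + D * τ := by
      rw [← hwn]
      linarith [norm_sub_norm_le w' w]
    have hkσ : toComplexThree (w' - w) = (k : ℂ) • σ := by
      rw [hww, toComplexThree_axisPoint, hσdef, smul_smul]
      congr 1
      push_cast
      ring
    have h1 := hstrict i ζ hζ w' (by rw [mem_ball_zero_iff]; linarith) w
      (by rw [mem_ball_zero_iff, hwn]; linarith)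
    rw [hkσ] at h1
    have hj := h.jump i j ζ hζ ζ' hζ' w' (by rw [mem_ball_zero_iff]; linarith) w
      (by rw [mem_ball_zero_iff, hwn]; linarith) (he.apply_eq hL w)
    have h2 := hle i ζ hζ w' (by rw [mem_ball_zero_iff]; linarith)
    have hlip := norm_sub_le_of_fderiv_eq_zero (h.holomorphic i j ζ hζ ζ' hζ' hL)
      (h.norm_le_one i j ζ hζ ζ' hζ' hL) (h.apply_zero he ht hζ hζ' hL)
      (h.fderiv_zero he ht hζ hζ' hL) hs hsR (x := Q i ζ w') (y := v (i, ζ))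
      (by rw [mem_ball_zero_iff]; linarith)
      (by rw [mem_ball_zero_iff]; linarith [hvs (i, ζ)])
    have h3 : ‖(k : ℂ) • σ‖ ≤ D * τ := by
      rw [← hkσ]
      exact (norm_toComplexThree_le _).trans hdist
    have h4 : κ * ‖w' - w‖ ≤ κ * (D * τ) := by gcongr
    have h5 : κ * (D * τ) ≤ D * τ := by nlinarith
    have h6 : ‖Q i ζ w' - v (i, ζ)‖ ≤ M + 2 * (D * τ) := by
      have : Q i ζ w' - v (i, ζ) = (Q i ζ w - v (i, ζ)) + (Q i ζ w' - Q i ζ w - (k : ℂ) • σ) +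
        (k : ℂ) • σ := by abel
      rw [this]
      have := norm_add₃_le (a := Q i ζ w - v (i, ζ)) (b := Q i ζ w' - Q i ζ w - (k : ℂ) • σ)
        (c := (k : ℂ) • σ)
      linarith [hM i ζ hζ]
    have h7 : ‖n i j ζ ζ' (Q i ζ w') - n i j ζ ζ' (v (i, ζ))‖ ≤ κ * (M + 2 * (D * τ)) :=
      hlip.trans (mul_le_mul hsκ h6 (norm_nonneg _) hκ.le)
    have h8 : Q j ζ' w - v (j, ζ') - (Q i ζ w - v (i, ζ)) - (k : ℂ) • σ =
        (Q i ζ w' - Q i ζ w - (k : ℂ) • σ) +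
          (n i j ζ ζ' (Q i ζ w') - n i j ζ ζ' (v (i, ζ))) := by
      rw [hj, hvj i j ζ hζ ζ' hζ' hL]
      abel
    rw [h8]
    exact (norm_add_le _ _).trans (add_le_add (h1.trans h4) h7)
  obtain ⟨hd, hσ'⟩ := hap _ σ _ (2 * s) (fun i => (h.differentiableOn i w
    (by rw [mem_ball_zero_iff, hwn]; linarith)).sub (hv i).1) (by simp [hv₀, hw]) hbdd hjb
  have hM' := hMle _ hd
  rw [hσ] at hσ'
  have hfinal : τ ≤ 0 := by
    have e1 : C * (κ * (D * τ) + κ * (M + 2 * (D * τ))) =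
      C * (κ * D + 2 * D * κ) * τ + C * κ * M := by ring
    rw [e1] at hσ' hM'
    have e2 : C * (κ * D + 2 * D * κ) * τ ≤ 1 / 4 * τ := by gcongr
    have hM0 : 0 ≤ M := (norm_nonneg _).trans (hM i₀ _ (hp i₀))
    have e3 : C * κ * M ≤ 1 / 4 * M := by gcongr
    linarith
  have : |t u - 1| = 0 := le_antisymm (hτ ▸ hfinal) (abs_nonneg _)
  linarith [abs_eq_zero.1 this]

end Rigidity

section Charts

open Metric

/-- Strict differentiability holds uniformly on compact sets. -/
theorem IsCompact.exists_norm_sub_sub_fderiv_le {V F : Type*} [NormedAddCommGroup V]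
    [NormedSpace ℝ V] [NormedAddCommGroup F] [NormedSpace ℝ F] {f : V → F} {Ω K : Set V}
    (hΩ : IsOpen Ω) (hf : ContDiffOn ℝ (⊤ : ℕ∞) f Ω) (hK : IsCompact K) (hKΩ : K ⊆ Ω)
    {ε : ℝ} (hε : 0 < ε) : ∃ s > 0, ∀ x ∈ K, ∀ w ∈ ball (0 : V) s, ∀ w' ∈ ball (0 : V) s,
      x + w ∈ Ω ∧ ‖f (x + w) - f (x + w') - fderiv ℝ f x (w - w')‖ ≤ ε * ‖w - w'‖ := by
  have key : ∀ᶠ q : V × V in 𝓝 (0, 0), ∀ x ∈ K, x + q.1 ∈ Ω ∧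
      ‖f (x + q.1) - f (x + q.2) - fderiv ℝ f x (q.1 - q.2)‖ ≤ ε * ‖q.1 - q.2‖ := by
    refine hK.eventually_forall_of_forall_eventually fun x₀ hx₀ => ?_
    have hat : ContDiffAt ℝ (⊤ : ℕ∞) f x₀ := hf.contDiffAt (hΩ.mem_nhds (hKΩ hx₀))
    have hstrict := (hat.hasStrictFDerivAt (by simp)).isLittleO.def (half_pos hε)
    have hcont : ContinuousAt (fderiv ℝ f) x₀ :=
      ((hf.continuousOn_fderiv_of_isOpen hΩ (by simp)).continuousAt (hΩ.mem_nhds (hKΩ hx₀)))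
    have hclose : ∀ᶠ x in 𝓝 x₀, ‖fderiv ℝ f x - fderiv ℝ f x₀‖ < ε / 2 := by
      filter_upwards [hcont.eventually (ball_mem_nhds _ (half_pos hε))] with x hx
      rwa [dist_eq_norm] at hx
    have t1 : Tendsto (fun z : (V × V) × V => z.2 + z.1.1) (𝓝 ((0, 0), x₀)) (𝓝 x₀) :=
      Continuous.tendsto' (by fun_prop) _ _ (by simp)
    have t2 : Tendsto (fun z : (V × V) × V => (z.2 + z.1.1, z.2 + z.1.2)) (𝓝 ((0, 0), x₀))
      (𝓝 (x₀, x₀)) := Continuous.tendsto' (by fun_prop) _ _ (by simp)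
    have t3 : Tendsto (fun z : (V × V) × V => z.2) (𝓝 ((0, 0), x₀)) (𝓝 x₀) :=
      Continuous.tendsto' (by fun_prop) _ _ (by simp)
    filter_upwards [t1.eventually (hΩ.mem_nhds (hKΩ hx₀)), t2.eventually hstrict,
      t3.eventually hclose] with z h1 h2 h3
    refine ⟨h1, ?_⟩
    simp only [add_sub_add_left_eq_sub] at h2
    have h4 : f (z.2 + z.1.1) - f (z.2 + z.1.2) - fderiv ℝ f z.2 (z.1.1 - z.1.2) =
        (f (z.2 + z.1.1) - f (z.2 + z.1.2) - fderiv ℝ f x₀ (z.1.1 - z.1.2)) -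
          (fderiv ℝ f z.2 - fderiv ℝ f x₀) (z.1.1 - z.1.2) := by
      rw [_root_.sub_apply]
      abel
    rw [h4]
    have h5 := ((fderiv ℝ f z.2 - fderiv ℝ f x₀).le_opNorm (z.1.1 - z.1.2)).trans
      (mul_le_mul_of_nonneg_right h3.le (norm_nonneg _))
    linarith [norm_sub_le (f (z.2 + z.1.1) - f (z.2 + z.1.2) - fderiv ℝ f x₀ (z.1.1 - z.1.2))
      ((fderiv ℝ f z.2 - fderiv ℝ f x₀) (z.1.1 - z.1.2))]
  obtain ⟨s, hs, H⟩ := Metric.eventually_nhds_iff_ball.1 key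
  refine ⟨s, hs, fun x hx w hw w' hw' => H (w, w') ?_ x hx⟩
  rw [← ball_prod_same]
  exact ⟨hw, hw'⟩

/-- The complex linear extension of a real linear map on `ℂ² × ℝ`. -/
noncomputable def complexExtension (L : Model 2 →L[ℝ] (Fin 3 → ℂ)) :
    (Fin 3 → ℂ) →L[ℂ] (Fin 3 → ℂ) :=
  ∑ k : Fin 3, ContinuousLinearMap.smulRightL ℂ (Fin 3 → ℂ) (Fin 3 → ℂ)
    (ContinuousLinearMap.proj k) (L (![(![1, 0], 0), (![0, 1], 0), (0, 1)] k))

theorem complexExtension_apply (L : Model 2 →L[ℝ] (Fin 3 → ℂ)) (c : Fin 3 → ℂ) :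
    complexExtension L c = c 0 • L (![1, 0], 0) + c 1 • L (![0, 1], 0) + c 2 • L (0, 1) := by
  simp [complexExtension, Fin.sum_univ_three]

/-- Complex linearity along the leaves. -/
def IsLeafwiseLinear (L : Model 2 →L[ℝ] (Fin 3 → ℂ)) : Prop :=
  ∀ (c : ℂ) (y : Fin 2 → ℂ), L (c • y, 0) = c • L (y, 0)

namespace IsLeafwiseLinear

variable {L : Model 2 →L[ℝ] (Fin 3 → ℂ)}

theorem complexExtension_toComplexThree (hL : IsLeafwiseLinear L) (w : Model 2) :
    complexExtension L (toComplexThree w) = L w := by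
  have hw : w = (w.1 0 • ![1, 0], 0) + (w.1 1 • ![0, 1], 0) + w.2 • (0, 1) := by
    ext k
    · fin_cases k <;> simp
    · simp
  rw [complexExtension_apply]
  conv_rhs => rw [hw]
  rw [map_add, map_add, hL, hL, map_smul, toComplexThree_apply]
  simp

theorem isUnit_complexExtension (hL : IsLeafwiseLinear L) (hinj : Function.Injective L) :
    IsUnit (complexExtension L) := by
  have hi : Function.Injective (complexExtension L) := by
    rw [injective_iff_map_eq_zero]
    intro c hc
    by_cases h2 : c 2 = 0
    · have h1 : toComplexThree (![c 0, c 1], 0) = c := by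
        ext k
        fin_cases k <;> simp [toComplexThree_apply, h2]
      rw [← h1, hL.complexExtension_toComplexThree, map_eq_zero_iff L hinj] at hc
      rw [← h1, hc, map_zero]
    · have h1 : toComplexThree (![(c 2)⁻¹ * c 0, (c 2)⁻¹ * c 1], 1) = (c 2)⁻¹ • c := by
        ext k
        fin_cases k <;> simp [toComplexThree_apply, h2]
      have h3 : complexExtension L ((c 2)⁻¹ • c) = 0 := by rw [map_smul, hc, smul_zero]
      rw [← h1, hL.complexExtension_toComplexThree, map_eq_zero_iff L hinj] at h3
      exact absurd (congrArg Prod.snd h3) one_ne_zero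
  rw [ContinuousLinearMap.isUnit_iff_bijective]
  exact ⟨hi, LinearMap.injective_iff_surjective.1 hi⟩

theorem span_range_eq_top (hL : IsLeafwiseLinear L) (hinj : Function.Injective L) :
    Submodule.span ℂ (range L) = ⊤ := by
  rw [eq_top_iff]
  rintro x -
  obtain ⟨c, rfl⟩ := (ContinuousLinearMap.isUnit_iff_bijective.1
    (hL.isUnit_complexExtension hinj)).2 x
  rw [complexExtension_apply]
  have hmem : ∀ w, L w ∈ Submodule.span ℂ (range L) := fun w => Submodule.subset_span ⟨w, rfl⟩
  exact add_mem (add_mem (Submodule.smul_mem _ _ (hmem _)) (Submodule.smul_mem _ _ (hmem _)))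
    (Submodule.smul_mem _ _ (hmem _))

end IsLeafwiseLinear

/-- `E` is a smooth leafwise holomorphic immersion of the open set `Ω ⊆ ℂ² × ℝ` into `ℂ³`. -/
structure IsLeviFlatImmersionOn (E : Model 2 → (Fin 3 → ℂ)) (Ω : Set (Model 2)) : Prop where
  isOpen : IsOpen Ω
  contDiffOn : ContDiffOn ℝ (⊤ : ℕ∞) E Ω
  leafwise : ∀ x ∈ Ω, DifferentiableAt ℂ (fun z => E (z, x.2)) x.1
  injective : ∀ x ∈ Ω, Function.Injective (fderiv ℝ E x)

/-- The directional derivatives at the point `ζ` of the central curve as a complex frame. -/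
noncomputable def axisFrame (E : Model 2 → (Fin 3 → ℂ)) (ζ : ℂ) :
    (Fin 3 → ℂ) →L[ℂ] (Fin 3 → ℂ) := complexExtension (fderiv ℝ E (axisPoint ζ))

/-- The displacement of the translate by `w` from the central curve, in terms of the frame
`axisFrame E`. -/
noncomputable def axisDisplacement (E : Model 2 → (Fin 3 → ℂ)) (ζ : ℂ) (w : Model 2) :
    Fin 3 → ℂ :=
  Ring.inverse (axisFrame E ζ) (E (axisPoint ζ + w) - E (axisPoint ζ))

theorem continuous_axisPoint : Continuous axisPoint := by
  unfold axisPoint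
  fun_prop

namespace IsLeviFlatImmersionOn

variable {E : Model 2 → (Fin 3 → ℂ)} {Ω : Set (Model 2)}

theorem differentiableAt (h : IsLeviFlatImmersionOn E Ω) {x : Model 2} (hx : x ∈ Ω) :
    DifferentiableAt ℝ E x :=
  (h.contDiffOn.contDiffAt (h.isOpen.mem_nhds hx)).differentiableAt (by simp)

theorem isLeafwiseLinear (h : IsLeviFlatImmersionOn E Ω) {x : Model 2} (hx : x ∈ Ω) :
    IsLeafwiseLinear (fderiv ℝ E x) := by
  have h1 : HasFDerivAt (fun z => E (z, x.2))
      ((fderiv ℝ E x).comp (ContinuousLinearMap.inl ℝ (Fin 2 → ℂ) ℝ)) x.1 :=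
    HasFDerivAt.comp x.1 (h.differentiableAt hx).hasFDerivAt (hasFDerivAt_prodMk_left x.1 x.2)
  have h2 := (h.leafwise x hx).hasFDerivAt.restrictScalars ℝ
  have h3 := h1.unique h2
  intro c y
  have h4 : ∀ y, fderiv ℝ E x (y, 0) = fderiv ℂ (fun z => E (z, x.2)) x.1 y := fun y =>
    DFunLike.congr_fun h3 y
  rw [h4, h4, map_smul]

theorem differentiableAt_axisPoint_add (h : IsLeviFlatImmersionOn E Ω) {ζ : ℂ} {w : Model 2}
    (hw : axisPoint ζ + w ∈ Ω) : DifferentiableAt ℂ (fun ζ => E (axisPoint ζ + w)) ζ := by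
  have h1 := h.leafwise _ hw
  have h2 : DifferentiableAt ℂ (fun ζ : ℂ => (axisPoint ζ + w).1) ζ := by
    rw [differentiableAt_pi]
    intro k
    fin_cases k <;> simp [axisPoint]
  have h3 := DifferentiableAt.comp ζ h1 h2
  exact h3

theorem differentiableAt_fderiv_axisPoint (h : IsLeviFlatImmersionOn E Ω) {ζ : ℂ}
    (hζ : axisPoint ζ ∈ Ω) (v : Model 2) :
    DifferentiableAt ℂ (fun ζ => fderiv ℝ E (axisPoint ζ) v) ζ := by
  obtain ⟨ρ, hρ, hρΩ⟩ := Metric.nhds_basis_closedBall.mem_iff.1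
    (continuous_axisPoint.continuousAt.preimage_mem_nhds (h.isOpen.mem_nhds hζ))
  have hK : IsCompact (axisPoint '' closedBall ζ ρ) :=
    (isCompact_closedBall ζ ρ).image continuous_axisPoint
  have hKΩ : axisPoint '' closedBall ζ ρ ⊆ Ω := image_subset_iff.2 hρΩ
  have hsv : ∀ s > 0, ∀ᶠ a in 𝓝[≠] (0 : ℝ), a • v ∈ ball (0 : Model 2) s := by
    intro s hs
    have : Tendsto (fun a : ℝ => a • v) (𝓝 0) (𝓝 0) :=
      Continuous.tendsto' (by fun_prop) _ _ (by simp)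
    exact (this.mono_left nhdsWithin_le_nhds).eventually (ball_mem_nhds _ hs)
  refine differentiableAt_of_tendstoUniformlyOn_ball hρ (l := 𝓝[≠] (0 : ℝ))
    (f := fun a ξ => a⁻¹ • (E (axisPoint ξ + a • v) - E (axisPoint ξ))) ?_ ?_
  · obtain ⟨s, hs, H⟩ := hK.exists_norm_sub_sub_fderiv_le h.isOpen h.contDiffOn hKΩ one_pos
    filter_upwards [hsv s hs] with a ha ξ hξ
    have hmem := mem_image_of_mem axisPoint (ball_subset_closedBall hξ)
    have h1 := h.differentiableAt_axisPoint_add (H _ hmem _ ha 0 (mem_ball_self hs)).1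
    have h2 := h.differentiableAt_axisPoint_add (w := 0) (ζ := ξ) (by simpa using hKΩ hmem)
    simp only [add_zero] at h2
    exact ((h1.sub h2).const_smul a⁻¹).differentiableWithinAt
  · rw [Metric.tendstoUniformlyOn_iff]
    intro ε hε
    have hε' : 0 < ε / (‖v‖ + 1) := by positivity
    obtain ⟨s, hs, H⟩ := hK.exists_norm_sub_sub_fderiv_le h.isOpen h.contDiffOn hKΩ hε'
    filter_upwards [hsv s hs, self_mem_nhdsWithin] with a ha ha0 ξ hξ
    have hmem := mem_image_of_mem axisPoint (ball_subset_closedBall hξ)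
    have h1 := (H _ hmem _ ha 0 (mem_ball_self hs)).2
    rw [add_zero, sub_zero, map_smul, norm_smul] at h1
    have ha0' : a ≠ 0 := ha0
    have h2 : a⁻¹ • (E (axisPoint ξ + a • v) - E (axisPoint ξ)) - fderiv ℝ E (axisPoint ξ) v =
        a⁻¹ • (E (axisPoint ξ + a • v) - E (axisPoint ξ) - a • fderiv ℝ E (axisPoint ξ) v) := by
      rw [smul_sub a⁻¹ (E (axisPoint ξ + a • v) - E (axisPoint ξ)), inv_smul_smul₀ ha0']
    rw [dist_comm, dist_eq_norm, h2, norm_smul, norm_inv, inv_mul_lt_iff₀ (norm_pos_iff.2 ha0')]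
    refine h1.trans_lt ?_
    have h3 : ε / (‖v‖ + 1) * ‖v‖ < ε := by
      rw [div_mul_eq_mul_div, div_lt_iff₀ (by positivity)]
      nlinarith
    have := mul_lt_mul_of_pos_left h3 (norm_pos_iff.2 ha0')
    linarith

theorem differentiableAt_axisFrame (h : IsLeviFlatImmersionOn E Ω) {ζ : ℂ}
    (hζ : axisPoint ζ ∈ Ω) : DifferentiableAt ℂ (axisFrame E) ζ := by
  unfold axisFrame complexExtension
  refine DifferentiableAt.fun_sum fun k _ => ?_
  exact (ContinuousLinearMap.differentiableAt _).comp ζ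
    (h.differentiableAt_fderiv_axisPoint hζ _)

theorem isUnit_axisFrame (h : IsLeviFlatImmersionOn E Ω) {ζ : ℂ} (hζ : axisPoint ζ ∈ Ω) :
    IsUnit (axisFrame E ζ) :=
  (h.isLeafwiseLinear hζ).isUnit_complexExtension (h.injective _ hζ)

theorem differentiableAt_inverse_axisFrame (h : IsLeviFlatImmersionOn E Ω) {ζ : ℂ}
    (hζ : axisPoint ζ ∈ Ω) : DifferentiableAt ℂ (fun ζ => Ring.inverse (axisFrame E ζ)) ζ :=
  (differentiableAt_inverse (𝕜 := ℂ) (h.isUnit_axisFrame hζ)).comp ζ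
    (h.differentiableAt_axisFrame hζ)

theorem inverse_axisFrame_apply (h : IsLeviFlatImmersionOn E Ω) {ζ : ℂ}
    (hζ : axisPoint ζ ∈ Ω) (x : Fin 3 → ℂ) :
    Ring.inverse (axisFrame E ζ) (axisFrame E ζ x) = x :=
  DFunLike.congr_fun (Ring.inverse_mul_cancel _ (h.isUnit_axisFrame hζ)) x

theorem axisFrame_inverse_apply (h : IsLeviFlatImmersionOn E Ω) {ζ : ℂ}
    (hζ : axisPoint ζ ∈ Ω) (x : Fin 3 → ℂ) :
    axisFrame E ζ (Ring.inverse (axisFrame E ζ) x) = x :=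
  DFunLike.congr_fun (Ring.mul_inverse_cancel _ (h.isUnit_axisFrame hζ)) x

end IsLeviFlatImmersionOn

end Charts

section Atlas

open Metric

theorem isClosed_squareLattice : IsClosed (squareLattice : Set ℂ) := by
  have h : (squareLattice : Set ℂ) =
      re ⁻¹' range ((↑) : ℤ → ℝ) ∩ im ⁻¹' range ((↑) : ℤ → ℝ) := by
    ext z
    constructor
    · rintro ⟨m, k, rfl⟩
      exact ⟨⟨m, by simp⟩, ⟨k, by simp⟩⟩
    · rintro ⟨⟨m, hm⟩, ⟨k, hk⟩⟩
      exact ⟨m, k, Complex.ext (by simp [hm]) (by simp [hk])⟩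
  rw [h]
  exact (Int.isClosedEmbedding_coe_real.isClosed_range.preimage continuous_re).inter
    (Int.isClosedEmbedding_coe_real.isClosed_range.preimage continuous_im)

theorem exists_pos_forall_of_finite {ι : Type*} [Finite ι] {P : ι → ℝ → Prop}
    (hP : ∀ i, ∃ s > 0, P i s) (hmono : ∀ i, ∀ s s', 0 < s' → s' ≤ s → P i s → P i s') :
    ∃ s > 0, ∀ i, P i s := by
  choose s hs H using hP
  rcases isEmpty_or_nonempty ι with hι | hι
  · exact ⟨1, one_pos, fun i => isEmptyElim i⟩
  · obtain ⟨i, hi⟩ := Finite.exists_min s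
    exact ⟨s i, hs i, fun j => hmono j _ _ (hs i) (hi j) (H j)⟩

namespace IsLeviFlatImmersionOn

variable {E : Model 2 → (Fin 3 → ℂ)} {Ω : Set (Model 2)}

theorem exists_norm_inverse_axisFrame_le (h : IsLeviFlatImmersionOn E Ω) {K : Set ℂ}
    (hK : IsCompact K) (hKΩ : ∀ ζ ∈ K, axisPoint ζ ∈ Ω) :
    ∃ B > 0, ∀ ζ ∈ K, ‖Ring.inverse (axisFrame E ζ)‖ ≤ B := by
  obtain ⟨B, hB⟩ := hK.exists_bound_of_continuousOn (f := fun ζ => Ring.inverse (axisFrame E ζ))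
    fun ζ hζ => (h.differentiableAt_inverse_axisFrame
      (hKΩ ζ hζ)).continuousAt.continuousWithinAt
  exact ⟨max B 1, lt_max_of_lt_right one_pos, fun ζ hζ => (hB ζ hζ).trans (le_max_left _ _)⟩

theorem inverse_axisFrame_fderiv (h : IsLeviFlatImmersionOn E Ω) {ζ : ℂ}
    (hζ : axisPoint ζ ∈ Ω) (w : Model 2) :
    Ring.inverse (axisFrame E ζ) (fderiv ℝ E (axisPoint ζ) w) = toComplexThree w := by
  rw [← (h.isLeafwiseLinear hζ).complexExtension_toComplexThree w]
  exact h.inverse_axisFrame_apply hζ _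

theorem exists_norm_axisDisplacement_sub_le (h : IsLeviFlatImmersionOn E Ω) {K : Set ℂ}
    (hK : IsCompact K) (hKΩ : ∀ ζ ∈ K, axisPoint ζ ∈ Ω) {η : ℝ} (hη : 0 < η) :
    ∃ s > 0, ∀ ζ ∈ K, ∀ w ∈ ball (0 : Model 2) s, ∀ w' ∈ ball (0 : Model 2) s,
      axisPoint ζ + w ∈ Ω ∧
      ‖axisDisplacement E ζ w - axisDisplacement E ζ w' - toComplexThree (w - w')‖ ≤
        η * ‖w - w'‖ := by
  obtain ⟨B, hB, hBK⟩ := h.exists_norm_inverse_axisFrame_le hK hKΩ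
  obtain ⟨s, hs, H⟩ := (hK.image continuous_axisPoint).exists_norm_sub_sub_fderiv_le h.isOpen
    h.contDiffOn (image_subset_iff.2 hKΩ) (div_pos hη hB)
  refine ⟨s, hs, fun ζ hζ w hw w' hw' => ?_⟩
  obtain ⟨h1, h2⟩ := H _ (mem_image_of_mem _ hζ) w hw w' hw'
  refine ⟨h1, ?_⟩
  have h3 : axisDisplacement E ζ w - axisDisplacement E ζ w' - toComplexThree (w - w') =
      Ring.inverse (axisFrame E ζ) (E (axisPoint ζ + w) - E (axisPoint ζ + w') -
        fderiv ℝ E (axisPoint ζ) (w - w')) := by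
    rw [← h.inverse_axisFrame_fderiv (hKΩ ζ hζ), axisDisplacement, axisDisplacement, ← map_sub,
      ← map_sub]
    congr 1
    abel
  rw [h3]
  calc _ ≤ B * (η / B * ‖w - w'‖) := (ContinuousLinearMap.le_opNorm _ _).trans
        (mul_le_mul (hBK ζ hζ) h2 (norm_nonneg _) hB.le)
    _ = η * ‖w - w'‖ := by field_simp

theorem differentiableAt_axisDisplacement (h : IsLeviFlatImmersionOn E Ω) {ζ : ℂ} {w : Model 2}
    (hζ : axisPoint ζ ∈ Ω) (hw : axisPoint ζ + w ∈ Ω) :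
    DifferentiableAt ℂ (fun ζ => axisDisplacement E ζ w) ζ := by
  have h1 := h.differentiableAt_axisPoint_add (w := 0) (ζ := ζ) (by simpa using hζ)
  simp only [add_zero] at h1
  exact (h.differentiableAt_inverse_axisFrame hζ).clm_apply
    ((h.differentiableAt_axisPoint_add hw).sub h1)

theorem axisFrame_axisDisplacement (h : IsLeviFlatImmersionOn E Ω) {ζ : ℂ}
    (hζ : axisPoint ζ ∈ Ω) (w : Model 2) :
    E (axisPoint ζ) + axisFrame E ζ (axisDisplacement E ζ w) = E (axisPoint ζ + w) := by
  rw [axisDisplacement, h.axisFrame_inverse_apply hζ, add_sub_cancel]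

theorem hasFDerivAt_axisDisplacement (h : IsLeviFlatImmersionOn E Ω) {ζ : ℂ} {w : Model 2}
    (hw : axisPoint ζ + w ∈ Ω) : HasFDerivAt (axisDisplacement E ζ)
      (((Ring.inverse (axisFrame E ζ)).restrictScalars ℝ).comp
        (fderiv ℝ E (axisPoint ζ + w))) w := by
  have h1 : HasFDerivAt (fun w => E (axisPoint ζ + w) - E (axisPoint ζ))
      (fderiv ℝ E (axisPoint ζ + w)) w := by
    refine HasFDerivAt.sub_const _ ?_
    exact (hasFDerivAt_comp_add_left (axisPoint ζ)).2 (h.differentiableAt hw).hasFDerivAt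
  exact ((Ring.inverse (axisFrame E ζ)).restrictScalars ℝ).hasFDerivAt.comp w h1

theorem span_range_fderiv_axisDisplacement (h : IsLeviFlatImmersionOn E Ω) {ζ : ℂ} {w : Model 2}
    (hζ : axisPoint ζ ∈ Ω) (hw : axisPoint ζ + w ∈ Ω) :
    Submodule.span ℂ (range (fderiv ℝ (axisDisplacement E ζ) w)) = ⊤ := by
  have h1 : range (fderiv ℝ (axisDisplacement E ζ) w) =
      (Ring.inverse (axisFrame E ζ)).toLinearMap ''
        range (fderiv ℝ E (axisPoint ζ + w)) := by
    rw [(h.hasFDerivAt_axisDisplacement hw).fderiv, ← range_comp]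
    rfl
  rw [h1, Submodule.span_image,
    (h.isLeafwiseLinear hw).span_range_eq_top (h.injective _ hw), Submodule.map_top,
    LinearMap.range_eq_top]
  exact fun x => ⟨axisFrame E ζ x, h.inverse_axisFrame_apply hζ x⟩

end IsLeviFlatImmersionOn

/-- The deviation from the identity of the coordinate change `T`, read in the frames along the
central curve over the points `ζ` and `ζ'`. -/
noncomputable def frameTransition (E E' : Model 2 → (Fin 3 → ℂ))
    (T : (Fin 3 → ℂ) → (Fin 3 → ℂ)) (ζ ζ' : ℂ) (v : Fin 3 → ℂ) : Fin 3 → ℂ :=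
  Ring.inverse (axisFrame E' ζ') (T (E (axisPoint ζ) + axisFrame E ζ v) - E' (axisPoint ζ')) - v

/-- Charts `E i` around the discs `ball (p i) (2 * ρ i)` of the central curve with holomorphic
coordinate changes `T i j`. -/
structure IsAxisAtlas {X ι : Type*} (e : Model 2 → X) (p : ι → ℂ) (ρ : ι → ℝ)
    (E : ι → Model 2 → (Fin 3 → ℂ)) (Ω : ι → Set (Model 2)) (D : ι → ι → Set (Fin 3 → ℂ))
    (T : ι → ι → (Fin 3 → ℂ) → (Fin 3 → ℂ)) : Prop where
  immersion : ∀ i, IsLeviFlatImmersionOn (E i) (Ω i)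
  axisPoint_mem : ∀ i, ∀ ζ ∈ closedBall (p i) (2 * ρ i), axisPoint ζ ∈ Ω i
  isOpen : ∀ i j, IsOpen (D i j)
  differentiableOn : ∀ i j, DifferentiableOn ℂ (T i j) (D i j)
  transition : ∀ i j, ∀ x ∈ Ω i, ∀ x' ∈ Ω j, e x = e x' →
    E i x ∈ D i j ∧ T i j (E i x) = E j x'

namespace IsAxisAtlas

variable {X ι : Type*} {e : Model 2 → X} {p : ι → ℂ} {ρ : ι → ℝ} {E : ι → Model 2 → (Fin 3 → ℂ)}
  {Ω : ι → Set (Model 2)} {D : ι → ι → Set (Fin 3 → ℂ)}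
  {T : ι → ι → (Fin 3 → ℂ) → (Fin 3 → ℂ)}

theorem exists_frameTransition_le (h : IsAxisAtlas e p ρ E Ω D T)
    (he : ∀ ζ ζ', ζ - ζ' ∈ squareLattice → e (axisPoint ζ) = e (axisPoint ζ')) (i j : ι) :
    ∃ R > 0, ∀ ζ ∈ closedBall (p i) (2 * ρ i), ∀ ζ' ∈ closedBall (p j) (2 * ρ j),
      ζ - ζ' ∈ squareLattice → ∀ v ∈ ball 0 R, E i (axisPoint ζ) + axisFrame (E i) ζ v ∈ D i j ∧
        ‖frameTransition (E i) (E j) (T i j) ζ ζ' v‖ ≤ 1 := by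
  have hK : IsCompact ((closedBall (p i) (2 * ρ i) ×ˢ closedBall (p j) (2 * ρ j)) ∩
      {q : ℂ × ℂ | q.1 - q.2 ∈ squareLattice}) :=
    ((isCompact_closedBall _ _).prod (isCompact_closedBall _ _)).inter_right
      (isClosed_squareLattice.preimage (continuous_fst.sub continuous_snd))
  have key : ∀ᶠ v in 𝓝 (0 : Fin 3 → ℂ), ∀ q ∈ (closedBall (p i) (2 * ρ i) ×ˢ
      closedBall (p j) (2 * ρ j)) ∩ {q : ℂ × ℂ | q.1 - q.2 ∈ squareLattice},
      E i (axisPoint q.1) + axisFrame (E i) q.1 v ∈ D i j ∧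
        ‖frameTransition (E i) (E j) (T i j) q.1 q.2 v‖ ≤ 1 := by
    refine hK.eventually_forall_of_forall_eventually ?_
    rintro ⟨ζ, ζ'⟩ ⟨⟨hζ, hζ'⟩, hL⟩
    have hm := h.axisPoint_mem i ζ hζ
    have hm' := h.axisPoint_mem j ζ' hζ'
    obtain ⟨h1, h2⟩ := h.transition i j _ hm _ hm' (he ζ ζ' hL)
    have c1 : ContinuousAt (fun z : (Fin 3 → ℂ) × ℂ × ℂ =>
        E i (axisPoint z.2.1) + axisFrame (E i) z.2.1 z.1) (0, ζ, ζ') := by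
      refine ContinuousAt.add ?_ (ContinuousAt.clm_apply ?_ continuousAt_fst)
      · exact ContinuousAt.comp (f := fun z : (Fin 3 → ℂ) × ℂ × ℂ => axisPoint z.2.1)
          ((h.immersion i).differentiableAt hm).continuousAt
          (continuous_axisPoint.comp (continuous_fst.comp continuous_snd)).continuousAt
      · exact ContinuousAt.comp (f := fun z : (Fin 3 → ℂ) × ℂ × ℂ => z.2.1) (x := (0, ζ, ζ'))
          ((h.immersion i).differentiableAt_axisFrame hm).continuousAt (by fun_prop)
    have v1 : E i (axisPoint ζ) + axisFrame (E i) ζ 0 = E i (axisPoint ζ) := by simp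
    have h1' : E i (axisPoint ζ) + axisFrame (E i) ζ 0 ∈ D i j := by rwa [v1]
    have c2 : ContinuousAt (fun z : (Fin 3 → ℂ) × ℂ × ℂ =>
        frameTransition (E i) (E j) (T i j) z.2.1 z.2.2 z.1) (0, ζ, ζ') := by
      unfold frameTransition
      refine ContinuousAt.sub (ContinuousAt.clm_apply ?_ (ContinuousAt.sub ?_ ?_))
        continuousAt_fst
      · exact ContinuousAt.comp (f := fun z : (Fin 3 → ℂ) × ℂ × ℂ => z.2.2) (x := (0, ζ, ζ'))
          ((h.immersion j).differentiableAt_inverse_axisFrame hm').continuousAt (by fun_prop)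
      · refine ContinuousAt.comp (f := fun z : (Fin 3 → ℂ) × ℂ × ℂ =>
          E i (axisPoint z.2.1) + axisFrame (E i) z.2.1 z.1) ?_ c1
        exact ((h.differentiableOn i j).differentiableAt
          ((h.isOpen i j).mem_nhds h1')).continuousAt
      · exact ContinuousAt.comp (f := fun z : (Fin 3 → ℂ) × ℂ × ℂ => axisPoint z.2.2)
          ((h.immersion j).differentiableAt hm').continuousAt
          (continuous_axisPoint.comp (continuous_snd.comp continuous_snd)).continuousAt
    have v2 : frameTransition (E i) (E j) (T i j) ζ ζ' 0 = 0 := by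
      simp [frameTransition, h2]
    refine (c1.eventually ((h.isOpen i j).mem_nhds h1')).and ?_
    have := c2.norm.eventually (Iic_mem_nhds (show ‖_‖ < 1 by rw [v2]; simp))
    exact this
  obtain ⟨R, hR, H⟩ := Metric.eventually_nhds_iff_ball.1 key
  exact ⟨R, hR, fun ζ hζ ζ' hζ' hL v hv => H v hv (ζ, ζ') ⟨⟨hζ, hζ'⟩, hL⟩⟩

theorem exists_isLinearising [Finite ι] (h : IsAxisAtlas e p ρ E Ω D T)
    (he : ∀ ζ ζ', ζ - ζ' ∈ squareLattice → e (axisPoint ζ) = e (axisPoint ζ'))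
    (hρ : ∀ i, 0 < ρ i) (i₀ : ι) : ∃ r R, IsLinearising e p ρ i₀ (fun i => axisDisplacement (E i))
      (fun i j => frameTransition (E i) (E j) (T i j)) r R := by
  have hstrict : ∀ η > 0, ∃ s > 0, ∀ i, ∀ ζ ∈ closedBall (p i) (2 * ρ i),
      ∀ w ∈ ball (0 : Model 2) s, ∀ w' ∈ ball (0 : Model 2) s, axisPoint ζ + w ∈ Ω i ∧
        ‖axisDisplacement (E i) ζ w - axisDisplacement (E i) ζ w' - toComplexThree (w - w')‖ ≤
          η * ‖w - w'‖ := fun η hη =>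
    exists_pos_forall_of_finite
      (fun i => (h.immersion i).exists_norm_axisDisplacement_sub_le (isCompact_closedBall _ _)
        (h.axisPoint_mem i) hη)
      fun i s s' _ hss' H ζ hζ w hw w' hw' =>
        H ζ hζ w (ball_subset_ball hss' hw) w' (ball_subset_ball hss' hw')
  obtain ⟨r, hr, hrΩ⟩ := hstrict 1 one_pos
  obtain ⟨R, hR, hRD⟩ := exists_pos_forall_of_finite (ι := ι × ι)
    (P := fun q R => ∀ ζ ∈ closedBall (p q.1) (2 * ρ q.1), ∀ ζ' ∈ closedBall (p q.2) (2 * ρ q.2),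
      ζ - ζ' ∈ squareLattice → ∀ v ∈ ball 0 R,
        E q.1 (axisPoint ζ) + axisFrame (E q.1) ζ v ∈ D q.1 q.2 ∧
          ‖frameTransition (E q.1) (E q.2) (T q.1 q.2) ζ ζ' v‖ ≤ 1)
    (fun q => h.exists_frameTransition_le he q.1 q.2)
    fun q s s' _ hss' H ζ hζ ζ' hζ' hL v hv => H ζ hζ ζ' hζ' hL v (ball_subset_ball hss' hv)
  have hΩ : ∀ i, ∀ ζ ∈ ball (p i) (2 * ρ i), axisPoint ζ ∈ Ω i := fun i ζ hζ =>
    h.axisPoint_mem i ζ (ball_subset_closedBall hζ)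
  have hΩw : ∀ i, ∀ ζ ∈ ball (p i) (2 * ρ i), ∀ w ∈ ball (0 : Model 2) r, axisPoint ζ + w ∈ Ω i :=
    fun i ζ hζ w hw => (hrΩ i ζ (ball_subset_closedBall hζ) w hw 0 (mem_ball_self hr)).1
  have hp : p i₀ ∈ ball (p i₀) (2 * ρ i₀) := mem_ball_self (by linarith [hρ i₀])
  refine ⟨r, R, ?_⟩
  constructor
  · exact hr
  · exact hR
  · intro i ζ
    simp [axisDisplacement]
  · intro i w hw ζ hζ
    exact ((h.immersion i).differentiableAt_axisDisplacement (hΩ i ζ hζ)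
      (hΩw i ζ hζ w hw)).differentiableWithinAt
  · intro η hη
    obtain ⟨s, hs, H⟩ := hstrict η hη
    exact ⟨s, hs, fun i ζ hζ w hw w' hw' => (H i ζ (ball_subset_closedBall hζ) w hw w' hw').2⟩
  · intro i j ζ hζ ζ' hζ' w hw w' hw' hew
    have h1 := (h.transition i j _ (hΩw i ζ hζ w hw) _ (hΩw j ζ' hζ' w' hw') hew).2
    simp only [frameTransition]
    rw [(h.immersion i).axisFrame_axisDisplacement (hΩ i ζ hζ), h1, add_sub_cancel]
    rfl
  · intro i j ζ hζ ζ' hζ' hL v hv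
    have h1 := (hRD (i, j) ζ (ball_subset_closedBall hζ) ζ' (ball_subset_closedBall hζ') hL v hv).1
    have h2 : DifferentiableAt ℂ (fun v => E i (axisPoint ζ) + axisFrame (E i) ζ v) v := by
      fun_prop
    have h3 := ((h.differentiableOn i j).differentiableAt ((h.isOpen i j).mem_nhds h1)).comp v h2
    exact (((Ring.inverse (axisFrame (E j) ζ')).differentiableAt.comp v
      (h3.sub_const _)).sub differentiableAt_id).differentiableWithinAt
  · intro i j ζ hζ ζ' hζ' hL v hv
    exact (hRD (i, j) ζ (ball_subset_closedBall hζ) ζ' (ball_subset_closedBall hζ') hL v hv).2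
  · intro w hw
    exact ((h.immersion i₀).hasFDerivAt_axisDisplacement (hΩw i₀ _ hp w hw)).differentiableAt
  · intro w hw
    exact (h.immersion i₀).span_range_fderiv_axisDisplacement (hΩ i₀ _ hp) (hΩw i₀ _ hp w hw)

end IsAxisAtlas

end Atlas

section Atlas

open Metric

theorem exists_sub_mem_squareLattice (ζ : ℂ) :
    ∃ ζ' ∈ Icc (0 : ℝ) 1 ×ℂ Icc (0 : ℝ) 1, ζ - ζ' ∈ squareLattice := by
  refine ⟨⟨Int.fract ζ.re, Int.fract ζ.im⟩, ?_, ⌊ζ.re⌋, ⌊ζ.im⌋, ?_⟩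
  · rw [mem_reProdIm]
    exact ⟨⟨Int.fract_nonneg _, (Int.fract_lt_one _).le⟩,
      ⟨Int.fract_nonneg _, (Int.fract_lt_one _).le⟩⟩
  · apply Complex.ext <;> simp

/-- A Levi-flat family of complex tori with periods `1` and `t u * I`, times a disc, which is
square for `u ≤ 0` is square near `u = 0` if it immerses into a complex manifold. -/
theorem LatticePeriodic.eventually_eq_one {X : Cpx 3} {e : Model 2 → X.X} {t : ℝ → ℝ}
    (he : LatticePeriodic e t) (ht : ∀ u ≤ 0, t u = 1) (htc : ContinuousAt t 0)
    (hX : ∀ a, IsLeviFlatImmersionOn (X.ψ a ∘ e) (e ⁻¹' X.O a)) : ∀ᶠ u in 𝓝 0, t u = 1 := by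
  choose a ha using fun ζ => X.covers (e (axisPoint ζ))
  have hnhds : ∀ ζ, ∃ ρ > 0, closedBall ζ (2 * ρ) ⊆ axisPoint ⁻¹' (e ⁻¹' X.O (a ζ)) := by
    intro ζ
    obtain ⟨δ, hδ, H⟩ := Metric.nhds_basis_closedBall.mem_iff.1
      (continuous_axisPoint.continuousAt.preimage_mem_nhds ((hX (a ζ)).isOpen.mem_nhds (ha ζ)))
    exact ⟨δ / 2, half_pos hδ, by rwa [mul_div_cancel₀ δ two_ne_zero]⟩
  choose ρ hρ hρX using hnhds
  obtain ⟨s, -, hs⟩ := (isCompact_Icc.reProdIm isCompact_Icc).elim_nhds_subcover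
    (s := Icc (0 : ℝ) 1 ×ℂ Icc (0 : ℝ) 1) (fun ζ => ball ζ (ρ ζ)) fun ζ _ => ball_mem_nhds _ (hρ ζ)
  choose T hT hTψ using X.trans
  have hcov : ∀ ζ, ∃ i : s, ∃ ζ' ∈ ball (i : ℂ) (ρ i), ζ - ζ' ∈ squareLattice := by
    intro ζ
    obtain ⟨ζ', hζ', hL⟩ := exists_sub_mem_squareLattice ζ
    obtain ⟨i, hi, hζi⟩ := mem_iUnion₂.1 (hs hζ')
    exact ⟨⟨i, hi⟩, ζ', hζi, hL⟩
  have hatlas : IsAxisAtlas e (fun i : s => (i : ℂ)) (fun i => ρ i) (fun i => X.ψ (a i) ∘ e)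
      (fun i => e ⁻¹' X.O (a i)) (fun i j => X.ψ (a i) '' (X.O (a i) ∩ X.O (a j)))
      (fun i j => T (a i) (a j)) := by
    constructor
    · exact fun i => hX _
    · exact fun i ζ hζ => hρX i hζ
    · exact fun i j => X.ψ_openMap _ _ inter_subset_left ((X.O_open _).inter (X.O_open _))
    · exact fun i j => hT _ _
    · intro i j x hx x' hx' hxx'
      have hmem : e x ∈ X.O (a i) ∩ X.O (a j) := ⟨hx, hxx' ▸ hx'⟩
      refine ⟨mem_image_of_mem _ hmem, ?_⟩
      rw [Function.comp_apply, Function.comp_apply, ← hxx', hTψ _ _ _ hmem]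
  have he0 : ∀ ζ ζ', ζ - ζ' ∈ squareLattice → e (axisPoint ζ) = e (axisPoint ζ') := by
    intro ζ ζ' hL
    simpa using he.apply_eq_of_eq_one hL (w := 0) (ht 0 le_rfl)
  obtain ⟨i₀, -⟩ := hcov 0
  obtain ⟨r, R, h⟩ := hatlas.exists_isLinearising he0 (fun i => hρ i) i₀
  exact h.eventually_eq_one he ht htc hcov fun i => hρ i

end Atlas

section TorusFamily

/-- The period of the torus over `u`: equal to `1` exactly for `u ≤ 0`. -/
noncomputable def torusPeriod (u : ℝ) : ℝ := 1 + expNegInvGlue u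

theorem torusPeriod_pos (u : ℝ) : 0 < torusPeriod u :=
  add_pos_of_pos_of_nonneg one_pos (expNegInvGlue.nonneg u)

theorem contDiff_torusPeriod : ContDiff ℝ (⊤ : ℕ∞) torusPeriod :=
  contDiff_const.add expNegInvGlue.contDiff

/-- The branch of the logarithm with imaginary part in `(α - π, α + π]`. -/
noncomputable def logBranch (α : ℝ) (w : ℂ) : ℂ := log (w * exp (-(α * I))) + α * I

theorem exp_logBranch (α : ℝ) {w : ℂ} (hw : w ≠ 0) : exp (logBranch α w) = w := by
  rw [logBranch, exp_add, exp_log (mul_ne_zero hw (exp_ne_zero _)), mul_assoc, ← exp_add]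
  simp

theorem logBranch_exp {α : ℝ} {z : ℂ} (hz : |z.im - α| < Real.pi) : logBranch α (exp z) = z := by
  obtain ⟨h1, h2⟩ := abs_lt.1 hz
  have him : (z + -(α * I)).im = z.im - α := by simp [sub_eq_add_neg]
  rw [logBranch, ← exp_add, log_exp (by rw [him]; exact h1) (by rw [him]; exact h2.le)]
  ring

theorem exp_mul_exp_mem_slitPlane {α : ℝ} {z : ℂ} (hz : |z.im - α| < Real.pi) :
    exp z * exp (-(α * I)) ∈ slitPlane := by
  obtain ⟨h1, h2⟩ := abs_lt.1 hz
  have him : (z + -(α * I)).im = z.im - α := by simp [sub_eq_add_neg]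
  rw [mem_slitPlane_iff_arg, ← exp_add, arg_exp, him]
  refine ⟨?_, exp_ne_zero _⟩
  rw [(toIocMod_eq_self Real.two_pi_pos).2 ⟨h1, by linarith⟩]
  exact h2.ne

theorem abs_im_logBranch_sub_lt {α : ℝ} {w : ℂ} (hw : w * exp (-(α * I)) ∈ slitPlane) :
    |(logBranch α w).im - α| < Real.pi := by
  have him : (logBranch α w).im - α = arg (w * exp (-(α * I))) := by simp [logBranch, log_im]
  rw [him, abs_lt]
  exact ⟨neg_pi_lt_arg _, lt_of_le_of_ne (arg_le_pi _) (mem_slitPlane_iff_arg.1 hw).1⟩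

theorem exists_mul_exp_mem_slitPlane {w w' : ℂ} (hw : w ≠ 0) (hw' : w' ≠ 0) :
    ∃ α : ℝ, w * exp (-(α * I)) ∈ slitPlane ∧ w' * exp (-(α * I)) ∈ slitPlane := by
  have h1 := neg_pi_lt_arg w
  have h2 := arg_le_pi w
  have h3 := neg_pi_lt_arg w'
  have h4 := arg_le_pi w'
  refine ⟨(arg w + arg w') / 2, ?_, ?_⟩
  · rw [← exp_log hw]
    refine exp_mul_exp_mem_slitPlane ?_
    rw [log_im, exp_log hw, abs_lt]
    constructor <;> linarith
  · rw [← exp_log hw']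
    refine exp_mul_exp_mem_slitPlane ?_
    rw [log_im, exp_log hw', abs_lt]
    constructor <;> linarith

theorem contDiffAt_logBranch {α : ℝ} {w : ℂ} (hw : w * exp (-(α * I)) ∈ slitPlane) :
    ContDiffAt ℝ (⊤ : ℕ∞) (logBranch α) w := by
  have h1 : ContDiffAt ℂ (⊤ : ℕ∞) (logBranch α) w :=
    (ContDiffAt.comp w (contDiffAt_log hw) (contDiffAt_id.mul contDiffAt_const)).add
      contDiffAt_const
  exact h1.restrict_scalars ℝ

/-- The smooth coordinates on `ℂ² × ℝ` in which the periods `1` and `torusPeriod u * I` of the first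
variable become the periods `2πi` of the first and second variable. -/
noncomputable def straighten : Model 2 ≃ Model 2 where
  toFun x := (![(x.1 1).re + (2 * Real.pi * (x.1 0).re : ℝ) * I,
    (x.1 1).im + (2 * Real.pi * ((x.1 0).im / torusPeriod x.2) : ℝ) * I], x.2)
  invFun y := (![((y.1 0).im / (2 * Real.pi) : ℝ) +
    (torusPeriod y.2 * ((y.1 1).im / (2 * Real.pi)) : ℝ) * I,
    (y.1 0).re + (y.1 1).re * I], y.2)
  left_inv x := by
    have h1 := (torusPeriod_pos x.2).ne'
    have h2 := Real.pi_ne_zero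
    refine Prod.ext (funext fun k => ?_) rfl
    fin_cases k
    · apply Complex.ext
      · simp
      · simp
        field_simp
    · apply Complex.ext <;> simp
  right_inv y := by
    have h1 := (torusPeriod_pos y.2).ne'
    have h2 := Real.pi_ne_zero
    refine Prod.ext (funext fun k => ?_) rfl
    fin_cases k
    · apply Complex.ext
      · simp [-ofReal_div, -ofReal_mul]
      · simp [-ofReal_div, -ofReal_mul]
        field_simp
    · apply Complex.ext
      · simp [-ofReal_div, -ofReal_mul]
      · simp [-ofReal_div, -ofReal_mul]
        field_simp

theorem contDiff_ofReal_add_mul_I {f g : Model 2 → ℝ} (hf : ContDiff ℝ (⊤ : ℕ∞) f)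
    (hg : ContDiff ℝ (⊤ : ℕ∞) g) : ContDiff ℝ (⊤ : ℕ∞) fun x => (f x : ℂ) + g x * I :=
  (ofRealCLM.contDiff.comp hf).add ((ofRealCLM.contDiff.comp hg).mul contDiff_const)

theorem contDiff_coord (k : Fin 2) : ContDiff ℝ (⊤ : ℕ∞) fun x : Model 2 => x.1 k :=
  (contDiff_apply ℝ ℂ k).comp contDiff_fst

theorem contDiff_re_coord (k : Fin 2) : ContDiff ℝ (⊤ : ℕ∞) fun x : Model 2 => (x.1 k).re :=
  reCLM.contDiff.comp (contDiff_coord k)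

theorem contDiff_im_coord (k : Fin 2) : ContDiff ℝ (⊤ : ℕ∞) fun x : Model 2 => (x.1 k).im :=
  imCLM.contDiff.comp (contDiff_coord k)

theorem contDiff_torusPeriod_snd :
    ContDiff ℝ (⊤ : ℕ∞) fun x : Model 2 => torusPeriod x.2 :=
  contDiff_torusPeriod.comp contDiff_snd

theorem contDiff_straighten : ContDiff ℝ (⊤ : ℕ∞) straighten := by
  refine ContDiff.prodMk (contDiff_pi.2 fun k => ?_) contDiff_snd
  fin_cases k
  · exact contDiff_ofReal_add_mul_I (contDiff_re_coord 1) (contDiff_const.mul (contDiff_re_coord 0))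
  · exact contDiff_ofReal_add_mul_I (contDiff_im_coord 1) (contDiff_const.mul
      ((contDiff_im_coord 0).div contDiff_torusPeriod_snd fun x => (torusPeriod_pos _).ne'))

theorem contDiff_straighten_symm : ContDiff ℝ (⊤ : ℕ∞) straighten.symm := by
  refine ContDiff.prodMk (contDiff_pi.2 fun k => ?_) contDiff_snd
  fin_cases k
  · exact contDiff_ofReal_add_mul_I ((contDiff_im_coord 0).div_const _)
      (contDiff_torusPeriod_snd.mul ((contDiff_im_coord 1).div_const _))
  · exact contDiff_ofReal_add_mul_I (contDiff_re_coord 0) (contDiff_re_coord 1)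

/-- The translation by the period `2πi * m`. -/
noncomputable def deckShift (m : Fin 2 → ℤ) : Model 2 := (fun k => m k * (2 * Real.pi * I), 0)

theorem deckShift_re (m : Fin 2 → ℤ) (k : Fin 2) : ((deckShift m).1 k).re = 0 := by
  simp [deckShift]

theorem deckShift_im (m : Fin 2 → ℤ) (k : Fin 2) :
    ((deckShift m).1 k).im = m k * (2 * Real.pi) := by
  simp [deckShift]

theorem deckShift_snd (m : Fin 2 → ℤ) : (deckShift m).2 = 0 := rfl

theorem straighten_add_axisPoint (x : Model 2) (m : Fin 2 → ℤ) :
    straighten (x + axisPoint (m 0 + m 1 * (torusPeriod x.2 * I))) =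
      straighten x + deckShift m := by
  have h1 := (torusPeriod_pos x.2).ne'
  refine Prod.ext (funext fun k => ?_) (by simp [straighten, axisPoint, deckShift_snd])
  fin_cases k
  · apply Complex.ext
    · simp [straighten, axisPoint, deckShift_re]
    · simp [straighten, axisPoint, deckShift_im]
      ring
  · apply Complex.ext
    · simp [straighten, axisPoint, deckShift_re]
    · simp [straighten, axisPoint, deckShift_im]
      field_simp

/-- The exponential in both complex variables. -/
noncomputable def expPair (y : Model 2) : Model 2 := (fun k => exp (y.1 k), y.2)

theorem contDiff_expPair : ContDiff ℝ (⊤ : ℕ∞) expPair :=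
  (contDiff_pi.2 fun k => (contDiff_coord k).cexp).prodMk contDiff_snd

theorem expPair_add (y : Model 2) (m : Fin 2 → ℤ) :
    expPair (y + deckShift m) = expPair y := by
  refine Prod.ext (funext fun k => ?_) (by simp [expPair, deckShift_snd])
  exact exp_periodic.int_mul (m k) (y.1 k)

/-- The logarithm in both complex variables. -/
noncomputable def logPair (α : Fin 2 → ℝ) (p : Model 2) : Model 2 :=
  (fun k => logBranch (α k) (p.1 k), p.2)

/-- The domain of `logPair α`. -/
def slitDomain (α : Fin 2 → ℝ) : Set (Model 2) :=
  {p | ∀ k, p.1 k * exp (-(α k * I)) ∈ slitPlane}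

/-- The range of `logPair α`. -/
def logStrip (α : Fin 2 → ℝ) : Set (Model 2) := {y | ∀ k, |(y.1 k).im - α k| < Real.pi}

theorem isOpen_slitDomain (α : Fin 2 → ℝ) : IsOpen (slitDomain α) := by
  simp only [slitDomain, ofPred_forall]
  exact isOpen_iInter_of_finite fun k => isOpen_slitPlane.preimage (by fun_prop)

theorem isOpen_logStrip (α : Fin 2 → ℝ) : IsOpen (logStrip α) := by
  simp only [logStrip, ofPred_forall]
  exact isOpen_iInter_of_finite fun k => isOpen_lt (by fun_prop) continuous_const

theorem contDiffOn_logPair (α : Fin 2 → ℝ) : ContDiffOn ℝ (⊤ : ℕ∞) (logPair α) (slitDomain α) := by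
  intro p hp
  refine ContDiffAt.contDiffWithinAt (ContDiffAt.prodMk (contDiffAt_pi.2 fun k => ?_)
    contDiffAt_snd)
  exact (contDiffAt_logBranch (hp k)).comp p (contDiff_coord k).contDiffAt

theorem expPair_logPair (α : Fin 2 → ℝ) {p : Model 2} (hp : ∀ k, p.1 k ≠ 0) :
    expPair (logPair α p) = p :=
  Prod.ext (funext fun k => exp_logBranch (α k) (hp k)) rfl

theorem logPair_expPair {α : Fin 2 → ℝ} {y : Model 2} (hy : y ∈ logStrip α) :
    logPair α (expPair y) = y :=
  Prod.ext (funext fun k => logBranch_exp (hy k)) rfl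

theorem expPair_mem_slitDomain {α : Fin 2 → ℝ} {y : Model 2} (hy : y ∈ logStrip α) :
    expPair y ∈ slitDomain α := fun k => exp_mul_exp_mem_slitPlane (hy k)

theorem logPair_mem_logStrip {α : Fin 2 → ℝ} {p : Model 2} (hp : p ∈ slitDomain α) :
    logPair α p ∈ logStrip α := fun k => abs_im_logBranch_sub_lt (hp k)

theorem exists_eventually_logPair_expPair_eq {α : Fin 2 → ℝ} {y : Model 2}
    (hy : expPair y ∈ slitDomain α) : ∃ m : Fin 2 → ℤ, ∀ᶠ y' in 𝓝 y,
      logPair α (expPair y') = y' + deckShift m := by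
  have h1 : ∀ k, ∃ m : ℤ, logBranch (α k) (exp (y.1 k)) = y.1 k + m * (2 * Real.pi * I) :=
    fun k => exp_eq_exp_iff_exists_int.1 (exp_logBranch _ (exp_ne_zero _))
  choose m hm using h1
  have h2 : logPair α (expPair y) = y + deckShift m :=
    Prod.ext (funext hm) (by simp [logPair, expPair, deckShift_snd])
  have hmem : y + deckShift m ∈ logStrip α := h2 ▸ logPair_mem_logStrip hy
  refine ⟨m, ?_⟩
  have h3 : ContinuousAt (fun y' : Model 2 => y' + deckShift m) y := by
    fun_prop
  filter_upwards [h3.eventually ((isOpen_logStrip α).mem_nhds hmem)] with y' hy'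
  rw [← expPair_add y' m, logPair_expPair hy']

end TorusFamily

section TorusFamily

/-- The manifold `(ℂ ∖ 0)² × ℝ`. -/
abbrev PuncturedPair : Type := {p : Model 2 // ∀ k, p.1 k ≠ 0}

theorem isOpen_puncturedPair : IsOpen {p : Model 2 | ∀ k, p.1 k ≠ 0} := by
  simp only [ofPred_forall]
  exact isOpen_iInter_of_finite fun k => isOpen_ne_fun (by fun_prop) continuous_const

theorem isOpenMap_puncturedPair_val : IsOpenMap (Subtype.val : PuncturedPair → Model 2) :=
  isOpen_puncturedPair.isOpenMap_subtype_val

/-- The covering `ℂ² × ℝ → (ℂ ∖ 0)² × ℝ`. -/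
noncomputable def torusCovering (x : Model 2) : PuncturedPair :=
  ⟨expPair (straighten x), fun _ => exp_ne_zero _⟩

/-- The branches of the inverse of `torusCovering`. -/
noncomputable def torusChart (α : Fin 2 → ℝ) (p : PuncturedPair) : Model 2 :=
  straighten.symm (logPair α p.1)

/-- The domain of `torusChart α`. -/
def torusChartDomain (α : Fin 2 → ℝ) : Set PuncturedPair := Subtype.val ⁻¹' slitDomain α

theorem continuous_torusCovering : Continuous torusCovering :=
  (contDiff_expPair.continuous.comp contDiff_straighten.continuous).subtype_mk _

theorem isOpen_torusChartDomain (α : Fin 2 → ℝ) : IsOpen (torusChartDomain α) :=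
  (isOpen_slitDomain α).preimage continuous_subtype_val

theorem torusCovering_torusChart (α : Fin 2 → ℝ) (p : PuncturedPair) :
    torusCovering (torusChart α p) = p := by
  refine Subtype.ext ?_
  have h : expPair (straighten (torusChart α p)) = p.1 := by
    rw [torusChart, Equiv.apply_symm_apply]
    exact expPair_logPair α p.2
  exact h

theorem torusChart_torusCovering {α : Fin 2 → ℝ} {x : Model 2} (hx : straighten x ∈ logStrip α) :
    torusChart α (torusCovering x) = x := by
  rw [torusChart, torusCovering, logPair_expPair hx, Equiv.symm_apply_apply]

theorem image_torusChart {α : Fin 2 → ℝ} {W : Set PuncturedPair} (hW : W ⊆ torusChartDomain α) :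
    torusChart α '' W = straighten ⁻¹' logStrip α ∩ torusCovering ⁻¹' W := by
  ext x
  constructor
  · rintro ⟨p, hp, rfl⟩
    refine ⟨?_, by rwa [mem_preimage, torusCovering_torusChart]⟩
    rw [mem_preimage, torusChart, Equiv.apply_symm_apply]
    exact logPair_mem_logStrip (hW hp)
  · rintro ⟨h1, h2⟩
    exact ⟨torusCovering x, h2, torusChart_torusCovering h1⟩

theorem isOpen_image_torusChart {α : Fin 2 → ℝ} {W : Set PuncturedPair}
    (hW : W ⊆ torusChartDomain α) (hWo : IsOpen W) : IsOpen (torusChart α '' W) := by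
  rw [image_torusChart hW]
  exact ((isOpen_logStrip α).preimage contDiff_straighten.continuous).inter
    (hWo.preimage continuous_torusCovering)

theorem contDiffOn_straighten_symm_logPair (α : Fin 2 → ℝ) :
    ContDiffOn ℝ (⊤ : ℕ∞) (straighten.symm ∘ logPair α) (slitDomain α) :=
  contDiff_straighten_symm.comp_contDiffOn (contDiffOn_logPair α)

theorem contDiff_torusCovering_val : ContDiff ℝ (⊤ : ℕ∞) fun x => (torusCovering x).1 :=
  contDiff_expPair.comp contDiff_straighten

theorem exists_eventually_torusChart_torusCovering_eq {α : Fin 2 → ℝ} {x : Model 2}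
    (hx : torusCovering x ∈ torusChartDomain α) : ∃ m : Fin 2 → ℤ, ∀ᶠ x' in 𝓝 x,
      torusChart α (torusCovering x') =
        x' + axisPoint (m 0 + m 1 * (torusPeriod x'.2 * I)) := by
  obtain ⟨m, hm⟩ := exists_eventually_logPair_expPair_eq (y := straighten x) hx
  refine ⟨m, ?_⟩
  filter_upwards [contDiff_straighten.continuous.continuousAt.eventually hm] with x' hx'
  rw [torusChart, torusCovering, hx', ← straighten_add_axisPoint, Equiv.symm_apply_apply]

/-- The Levi-flat manifold `(ℂ ∖ 0)² × ℝ` whose leaf over `u` is the product of the elliptic curve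
with periods `1` and `torusPeriod u * I` and the complex line: the quotient of `ℂ² × ℝ` by these
lattices in the first variable. -/
noncomputable def torusFamily : Mfld 2 where
  M := PuncturedPair
  ι := Fin 2 → ℝ
  U := torusChartDomain
  U_open := isOpen_torusChartDomain
  covers p := by
    choose α hα using fun k => exists_mul_exp_mem_slitPlane (p.2 k) (p.2 k)
    exact ⟨α, fun k => (hα k).1⟩
  φ := torusChart
  φ_cont α := (contDiffOn_straighten_symm_logPair α).continuousOn.comp
    continuous_subtype_val.continuousOn fun _ hp => hp
  φ_inj α p _ q _ h := by
    rw [← torusCovering_torusChart α p, h, torusCovering_torusChart]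
  φ_openMap α W hW hWo := isOpen_image_torusChart hW hWo
  trans α β := by
    rw [image_torusChart inter_subset_left]
    refine ⟨fun x => torusChart β (torusCovering x), ?_, ?_, ?_, ?_⟩
    · exact (contDiffOn_straighten_symm_logPair β).comp contDiff_torusCovering_val.contDiffOn
        fun x hx => hx.2.2
    · intro p _
      exact congrArg (torusChart β) (torusCovering_torusChart α p).symm
    · exact fun p _ q _ h => h
    · intro p hp
      obtain ⟨m, hm⟩ := exists_eventually_torusChart_torusCovering_eq hp.2.2
      have hc : Tendsto (fun z : Fin 2 → ℂ => (z, p.2)) (𝓝 p.1) (𝓝 p) :=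
        Continuous.tendsto' (by fun_prop) _ _ rfl
      refine DifferentiableAt.differentiableWithinAt ?_
      have hd : DifferentiableAt ℂ (fun z : Fin 2 → ℂ =>
          z + (axisPoint (m 0 + m 1 * (torusPeriod p.2 * I))).1) p.1 := by fun_prop
      refine hd.congr_of_eventuallyEq ?_
      filter_upwards [hc.eventually hm] with z hz
      rw [hz]
      rfl

/-- The open subset `(ℂ ∖ 0)² × ℝ` of `ℂ² × ℝ` as a Levi-flat manifold. -/
noncomputable def puncturedPlanes : Mfld 2 where
  M := PuncturedPair
  ι := Unit
  U _ := univ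
  U_open _ := isOpen_univ
  covers _ := ⟨(), mem_univ _⟩
  φ _ := Subtype.val
  φ_cont _ := continuous_subtype_val.continuousOn
  φ_inj _ := Subtype.val_injective.injOn
  φ_openMap _ W _ hW := isOpenMap_puncturedPair_val W hW
  trans _ _ := ⟨id, contDiffOn_id, fun _ _ => rfl, fun _ _ _ _ h => h,
    fun _ _ => differentiableWithinAt_id⟩

theorem leaf_eq_of_plaqueRel_iff {m : ℕ} {S : Mfld m} {β : Type*} {f : S.M → β}
    (h : ∀ x y, plaqueRel S x y ↔ f x = f y) (x : S.M) : Leaf S x = {y | f x = f y} := by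
  have hS : Equivalence (plaqueRel S) :=
    ⟨fun x => (h x x).2 rfl, fun hxy => (h _ _).2 ((h _ _).1 hxy).symm,
      fun hxy hyz => (h _ _).2 (((h _ _).1 hxy).trans ((h _ _).1 hyz))⟩
  ext y
  exact hS.eqvGen_iff.trans (h x y)

theorem leaf_torusFamily (p : PuncturedPair) :
    Leaf torusFamily p = {q : PuncturedPair | p.1.2 = q.1.2} := by
  refine leaf_eq_of_plaqueRel_iff (S := torusFamily) (f := fun q : PuncturedPair => q.1.2)
    (fun p q => ⟨fun ⟨_, _, _, h⟩ => h, fun h => ?_⟩) p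
  choose α hα using fun k => exists_mul_exp_mem_slitPlane (p.2 k) (q.2 k)
  exact ⟨α, fun k => (hα k).1, fun k => (hα k).2, h⟩

theorem leaf_puncturedPlanes (p : PuncturedPair) :
    Leaf puncturedPlanes p = {q : PuncturedPair | p.1.2 = q.1.2} :=
  leaf_eq_of_plaqueRel_iff (S := puncturedPlanes) (f := fun q : PuncturedPair => q.1.2)
    (fun _ _ => ⟨fun ⟨_, _, _, h⟩ => h, fun h => ⟨(), mem_univ _, mem_univ _, h⟩⟩) p

theorem foliatedDiffeomorphic_torusFamily_puncturedPlanes :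
    FoliatedDiffeomorphic torusFamily puncturedPlanes := by
  refine ⟨Homeomorph.refl PuncturedPair, fun p => ?_, fun α _ => ?_, fun _ α => ?_⟩
  · exact (image_id _).trans ((leaf_torusFamily p).trans (leaf_puncturedPlanes p).symm)
  · refine ⟨fun x => (torusCovering x).1, contDiff_torusCovering_val.contDiffOn, fun p _ => ?_⟩
    exact congrArg Subtype.val (torusCovering_torusChart α p).symm
  · refine ⟨straighten.symm ∘ logPair α, (contDiffOn_straighten_symm_logPair α).mono ?_,
      fun p _ => rfl⟩
    rintro _ ⟨p, hp, rfl⟩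
    exact hp.2

theorem injective_toComplexThree : Function.Injective toComplexThree := by
  intro x y h
  rw [toComplexThree_apply, toComplexThree_apply] at h
  refine Prod.ext (funext fun k => ?_) (ofReal_injective (congrFun h 2))
  fin_cases k
  · exact congrFun h 0
  · exact congrFun h 1

theorem isLeviFlatEmbedding_puncturedPlanes :
    IsLeviFlatEmbedding puncturedPlanes (stdCpx 3) fun p : PuncturedPair => toComplexThree p.1 := by
  refine ⟨?_, fun _ _ => ⟨toComplexThree, toComplexThree.contDiff.contDiffOn, fun _ _ => rfl,
    fun p hp => ?_, fun p _ => DifferentiableAt.differentiableWithinAt ?_⟩⟩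
  · have h1 : IsEmbedding toComplexThree :=
      (toComplexThree.toLinearMap.isClosedEmbedding_of_injective
        (LinearMap.ker_eq_bot.2 injective_toComplexThree)).isEmbedding
    exact h1.comp IsEmbedding.subtypeVal
  · have ho : IsOpen ((Subtype.val : PuncturedPair → Model 2) '' (univ ∩ univ)) :=
      isOpenMap_puncturedPair_val _ (isOpen_univ.inter isOpen_univ)
    have h1 : Function.Injective (fderivWithin ℝ toComplexThree
        ((Subtype.val : PuncturedPair → Model 2) '' (univ ∩ univ)) p) := by
      rw [toComplexThree.fderivWithin (ho.uniqueDiffWithinAt hp)]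
      exact injective_toComplexThree
    exact h1
  · rw [differentiableAt_pi]
    intro k
    fin_cases k <;> simp [toComplexThree_apply]
    all_goals fun_prop

theorem latticePeriodic_torusCovering : LatticePeriodic torusCovering torusPeriod := by
  intro x m k
  refine Subtype.ext ?_
  have h := straighten_add_axisPoint x ![m, k]
  simp only [Matrix.cons_val_zero, Matrix.cons_val_one] at h
  exact (congrArg expPair h).trans (expPair_add _ _)

theorem isLeviFlatImmersionOn_comp_torusCovering {X : Cpx 3} {ε : PuncturedPair → X.X}
    (hε : IsLeviFlatEmbedding torusFamily X ε) (a : X.κ) :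
    IsLeviFlatImmersionOn (X.ψ a ∘ ε ∘ torusCovering) ((ε ∘ torusCovering) ⁻¹' X.O a) := by
  have hεc : Continuous ε := hε.1.continuous
  have key : ∀ x ∈ (ε ∘ torusCovering) ⁻¹' X.O a, ∃ (F : Model 2 → (Fin 3 → ℂ)) (W : Set (Model 2)),
      IsOpen W ∧ x ∈ W ∧ EqOn (X.ψ a ∘ ε ∘ torusCovering) F W ∧
        ContDiffOn ℝ (⊤ : ℕ∞) F W ∧ Function.Injective (fderivWithin ℝ F W x) ∧
        DifferentiableWithinAt ℂ (fun z => F (z, x.2)) {z | (z, x.2) ∈ W} x.1 := by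
    intro x hx
    have hs : straighten x ∈ logStrip fun k => ((straighten x).1 k).im := fun k => by
      simpa using Real.pi_pos
    obtain ⟨F, h1, h2, h3, h4⟩ := hε.2 (fun k => ((straighten x).1 k).im) a
    have hxW : x ∈ torusChart (fun k => ((straighten x).1 k).im) ''
        (torusChartDomain (fun k => ((straighten x).1 k).im) ∩ ε ⁻¹' X.O a) := by
      rw [image_torusChart inter_subset_left]
      exact ⟨hs, expPair_mem_slitDomain hs, hx⟩
    refine ⟨F, _, isOpen_image_torusChart inter_subset_left
      ((isOpen_torusChartDomain _).inter ((X.O_open a).preimage hεc)), hxW, ?_, h1, h3 x hxW,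
      h4 x hxW⟩
    rintro _ ⟨p, hp, rfl⟩
    rw [Function.comp_apply, Function.comp_apply, torusCovering_torusChart]
    exact h2 p hp
  constructor
  · exact (X.O_open a).preimage (hεc.comp continuous_torusCovering)
  · intro x hx
    obtain ⟨F, W, hW, hxW, heq, h1, -, -⟩ := key x hx
    exact ((h1.contDiffAt (hW.mem_nhds hxW)).congr_of_eventuallyEq
      (heq.eventuallyEq_of_mem (hW.mem_nhds hxW))).contDiffWithinAt
  · intro x hx
    obtain ⟨F, W, hW, hxW, heq, -, -, h4⟩ := key x hx
    have hW' : {z | (z, x.2) ∈ W} ∈ 𝓝 x.1 :=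
      (hW.preimage (Continuous.prodMk_left x.2)).mem_nhds hxW
    exact (h4.differentiableAt hW').congr_of_eventuallyEq
      (eventually_of_mem hW' fun z hz => heq hz)
  · intro x hx
    obtain ⟨F, W, hW, hxW, heq, -, h3, -⟩ := key x hx
    rw [(heq.eventuallyEq_of_mem (hW.mem_nhds hxW)).fderiv_eq, ← fderivWithin_of_isOpen hW hxW]
    exact h3

theorem not_admitsLeviFlatEmbedding_torusFamily : ¬ AdmitsLeviFlatEmbedding torusFamily 3 := by
  rintro ⟨X, ε, hε⟩
  have hper : LatticePeriodic (ε ∘ torusCovering) torusPeriod := fun x m k =>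
    congrArg ε (latticePeriodic_torusCovering x m k)
  have h := hper.eventually_eq_one
    (fun u hu => by rw [torusPeriod, expNegInvGlue.zero_of_nonpos hu, add_zero])
    contDiff_torusPeriod.continuous.continuousAt
    (isLeviFlatImmersionOn_comp_torusCovering hε)
  obtain ⟨u, hu, hu0⟩ := ((h.filter_mono nhdsWithin_le_nhds).and
    (self_mem_nhdsWithin (s := Ioi (0 : ℝ)))).exists
  exact (expNegInvGlue.pos_of_pos hu0).ne' (by simpa [torusPeriod] using hu)

end TorusFamily

/-- **Corollary 1.2 (cor:main)**. -/
theorem exists_foliated_diffeomorphic_embeddable_and_nonembeddable_levi_flats :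
    ∃ S1 S2 : Mfld 2,
      -- (i) `(M₁, 𝓕₁, J_{𝓕₁})` admits no Levi-flat `C^∞`-embedding into any
      -- complex 3-manifold
      ¬ AdmitsLeviFlatEmbedding S1 3 ∧
      -- (ii) `(M₂, 𝓕₂, J_{𝓕₂})` admits a Levi-flat `C^∞`-embedding into `ℂ³`
      (∃ e : S2.M → (stdCpx 3).X, IsLeviFlatEmbedding S2 (stdCpx 3) e) ∧
      -- (iii) `(M₁, 𝓕₁)` and `(M₂, 𝓕₂)` are diffeomorphic as `C^∞`-foliated
      -- manifolds
      FoliatedDiffeomorphic S1 S2 := by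
  exact ⟨torusFamily, puncturedPlanes, not_admitsLeviFlatEmbedding_torusFamily,
    ⟨_, isLeviFlatEmbedding_puncturedPlanes⟩, foliatedDiffeomorphic_torusFamily_puncturedPlanes⟩
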